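/- Suppose H is an algebraic k-hypergraph, δ = dep(H) is its depth, and κ is an infinite cardinal. If δ < ω, then χ(H) ≤ κ if and only if κ^{+δ} ≥ 2^{ℵ₀}; if δ = ∞, then χ(H) ≤ κ for every infinite κ. -/

import Mathlib

open Cardinal

universe u v

/-- `f` is one-to-one in each coordinate: if `a` and `b` differ in exactly one
coordinate, then `f a ≠ f b`. -/
def OneToOneEachCoord {d : ℕ} {X C : Type*} (f : (Fin d → X) → C) : Prop :=
  ∀ a b : Fin d → X, (∃ i, a i ≠ b i ∧ ∀ j, j ≠ i → a j = b j) → f a ≠ f b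

/-- `Q` is a homomorphic image of the template `P`: there is a surjection of `P`
onto `Q` preserving coordinate equalities. -/
def IsHomImage {d : ℕ} {α β : Type*} (P : Finset (Fin d → α)) (Q : Finset (Fin d → β)) : Prop :=
  ∃ f : (Fin d → α) → (Fin d → β),
    (∀ x ∈ P, f x ∈ Q) ∧ (∀ y ∈ Q, ∃ x ∈ P, f x = y) ∧
    (∀ x ∈ P, ∀ y ∈ P, ∀ i, x i = y i → f x i = f y i)

/-- The edge set of the template hypergraph `L(X^d, P)`: the edges are the
`k`-element subsets of `X^d` that are homomorphic images of `P`. -/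
def LEdges (k : ℕ) {d : ℕ} {α : Type*} (P : Finset (Fin d → α)) (X : Type*) :
    Set (Finset (Fin d → X)) :=
  {Q | Q.card = k ∧ IsHomImage P Q}

/-- Image of a finset (with classical decidable equality). -/
noncomputable def fimg {V W : Type*} (g : V → W) (e : Finset V) : Finset W :=
  @Finset.image _ _ (Classical.decEq W) g e

/-- `g` is an embedding of the hypergraph with edge set `E₁` into the one with
edge set `E₂`: an injection on vertices mapping every edge to an edge. -/
def IsHGEmbedding {V W : Type*} (E₁ : Set (Finset V)) (E₂ : Set (Finset W)) (g : V → W) : Prop :=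
  Function.Injective g ∧ ∀ e ∈ E₁, fimg g e ∈ E₂

def Embeddable {V W : Type*} (E₁ : Set (Finset V)) (E₂ : Set (Finset W)) : Prop :=
  ∃ g, IsHGEmbedding E₁ E₂ g

/-- The hypergraph with edge set `E` has a coloring with at most `κ` colors
that is not constant on any edge. -/
def ProperlyColorable {V : Type u} (E : Set (Finset V)) (κ : Cardinal.{u}) : Prop :=
  ∃ (C : Type u) (φ : V → C), #C ≤ κ ∧ ∀ e ∈ E, ∃ x ∈ e, ∃ y ∈ e, φ x ≠ φ y

/-- The chromatic number: the least `κ` admitting a proper `κ`-coloring. -/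
noncomputable def chromaticNumber {V : Type u} (E : Set (Finset V)) : Cardinal.{u} :=
  sInf {κ | ProperlyColorable E κ}

/-- The edge set of the zero `k`-hypergraph of a `(k,n)`-ary real polynomial:
the `k`-element subsets of `ℝ^n` admitting an enumeration on which `p` vanishes. -/
def zeroEdges (k n : ℕ) (p : MvPolynomial (Fin k × Fin n) ℝ) : Set (Finset (Fin n → ℝ)) :=
  {s | ∃ a : Fin k → (Fin n → ℝ), Function.Injective a ∧
        fimg a Finset.univ = s ∧ MvPolynomial.eval (fun v => a v.1 v.2) p = 0}

/-- `I` is a distinguisher for the template `P`: any two distinct elements of `P`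
differ at some coordinate in `I`. -/
def IsDistinguisher {d : ℕ} {α : Type*} (P : Finset (Fin d → α)) (I : Finset (Fin d)) : Prop :=
  ∀ x ∈ P, ∀ y ∈ P, x ≠ y → ∃ i ∈ I, x i ≠ y i

/-- `e(P)`: the least cardinality of a distinguisher for `P`. -/
noncomputable def eT {d : ℕ} {α : Type*} (P : Finset (Fin d → α)) : ℕ :=
  sInf {e | ∃ I : Finset (Fin d), IsDistinguisher P I ∧ I.card = e}

/-- The set of `δ < ω` witnessing the depth of a `k`-hypergraph: there is a
`d`-dimensional `k`-template `P` with `e(P) = δ + 1` such that `L(M^d, P)` is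
embeddable into the hypergraph for every `M < ω`.  The depth `dep(H)` is the
least element of this set, and is `∞` exactly when this set is empty. -/
def DepthSet (k : ℕ) {V : Type*} (E : Set (Finset V)) : Set ℕ :=
  {δ | ∃ (d : ℕ) (α : Type) (P : Finset (Fin d → α)), P.card = k ∧ eT P = δ + 1 ∧
       ∀ M : ℕ, Embeddable (LEdges k P (Fin M)) E}

section Derivations

open MvPolynomial

open scoped IntermediateField.algebraAdjoinAdjoin in
theorem IsTranscendenceBasis.exists_derivation {ι K L : Type*} [Field K] [Field L] [CharZero L]
    [Algebra K L] {x : ι → L} (hx : IsTranscendenceBasis K x) (η : ι → L) :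
    ∃ D : Derivation K L L, ∀ i, D (x i) = η i := by
  let : Algebra (MvPolynomial ι K) L := (aeval x).toAlgebra
  have hX : ∀ i, algebraMap (MvPolynomial ι K) L (X i) = x i := fun i => aeval_X x i
  have : IsScalarTower K (MvPolynomial ι K) L := .of_algebraMap_eq fun r => by
    rw [RingHom.algebraMap_toAlgebra]; simp
  let F := IntermediateField.adjoin K (Set.range x)
  let A := Algebra.adjoin K (Set.range x)
  have : Algebra.FormallyEtale (MvPolynomial ι K) L := by
    let : Algebra (MvPolynomial ι K) A := hx.1.aevalEquiv.toRingEquiv.toRingHom.toAlgebra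
    have : IsScalarTower (MvPolynomial ι K) A L := .of_algebraMap_eq fun r => by
      rw [RingHom.algebraMap_toAlgebra, RingHom.algebraMap_toAlgebra]
      exact (hx.1.algebraMap_aevalEquiv r).symm
    have : Algebra.FormallyEtale (MvPolynomial ι K) A :=
      .of_equiv (A := MvPolynomial ι K) ({ hx.1.aevalEquiv.toRingEquiv with
        commutes' := fun r => rfl } : MvPolynomial ι K ≃ₐ[MvPolynomial ι K] A)
    have : Algebra.FormallyEtale A F := .of_isLocalization (nonZeroDivisors _)
    have : Algebra.IsAlgebraic F L := hx.isAlgebraic_field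
    have : CharZero F := (algebraMap F L).charZero
    have : Algebra.FormallyEtale F L := Algebra.FormallyEtale.of_isSeparable _ L
    have : Algebra.FormallyEtale A L := .comp _ F _
    exact .comp _ A _
  have hb := KaehlerDifferential.isBaseChange_of_formallyEtale K (MvPolynomial ι K) L
  let D₀ : Derivation K (MvPolynomial ι K) L := mkDerivation K η
  refine ⟨(hb.lift D₀.liftKaehlerDifferential).compDer (KaehlerDifferential.D K L), fun i => ?_⟩
  have h1 := hb.lift_eq D₀.liftKaehlerDifferential (KaehlerDifferential.D K _ (X i))
  rw [KaehlerDifferential.map_D, hX] at h1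
  change hb.lift D₀.liftKaehlerDifferential (KaehlerDifferential.D K L (x i)) = _
  rw [h1]
  simp [D₀, mkDerivation_X]

theorem AlgebraicIndependent.exists_derivation {ι K L : Type*} [Field K] [Field L] [CharZero L]
    [Algebra K L] {x : ι → L} (hx : AlgebraicIndependent K x) (η : ι → L) :
    ∃ D : Derivation K L L, ∀ i, D (x i) = η i := by
  classical
  obtain ⟨t, hst, ht⟩ := exists_isTranscendenceBasis_superset hx.coe_range
  let ξ : t → L := fun z => if h : ∃ i, x i = z then η h.choose else 0
  obtain ⟨D, hD⟩ := ht.exists_derivation ξ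
  refine ⟨D, fun i => ?_⟩
  have h : ∃ j, x j = x i := ⟨i, rfl⟩
  have := hD ⟨x i, hst ⟨i, rfl⟩⟩
  simp only at this
  rw [this]
  simp only [ξ]
  rw [dif_pos h, hx.injective h.choose_spec]

end Derivations

section PartitionRelations

open Cardinal

theorem Cardinal.le_succ_iterate (κ : Cardinal.{0}) (n : ℕ) : κ ≤ Order.succ^[n] κ :=
  Order.le_succ_iterate n κ

/-- A Kuratowski-style decomposition of `X ^ d`. -/
theorem exists_coloring_of_card_le {κ : Cardinal.{0}} (hκ : ℵ₀ ≤ κ) (d δ : ℕ) :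
    ∀ X : Type, #X ≤ Order.succ^[δ] κ → ∃ (C : Type) (c : (Fin d → X) → C) (I : C → Finset (Fin d)),
      #C ≤ κ ∧ (∀ a, (I a).card ≤ δ) ∧
      ∀ x y, c x = c y → (∀ i ∈ I (c x), x i = y i) → x = y := by
  classical
  induction δ with
  | zero =>
    intro X hX
    refine ⟨Fin d → X, id, fun _ => ∅, ?_, by simp, fun x y h _ => h⟩
    rw [← Cardinal.power_def, mk_fin]
    exact (power_le_power_right (by simpa using hX)).trans (power_nat_le hκ)
  | succ δ ih =>
    intro X hX
    set μ := Order.succ^[δ] κ with hμ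
    have hμ0 : ℵ₀ ≤ μ := hκ.trans (κ.le_succ_iterate δ)
    rw [Function.iterate_succ_apply', ← hμ] at hX
    obtain ⟨C, c, I, hC, hI, hc⟩ := ih μ.out (by rw [mk_out])
    rcases Nat.eq_zero_or_pos d with rfl | hd
    · exact ⟨PUnit, fun _ => ⟨⟩, fun _ => ∅, (mk_le_aleph0).trans hκ, by simp,
        fun x y _ _ => Subsingleton.elim _ _⟩
    have : Nonempty (Fin d) := ⟨⟨0, hd⟩⟩
    obtain ⟨r, hr, hrX⟩ := Cardinal.exists_ord_eq X
    let : LinearOrder X := IsWellOrder.linearOrder r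
    have hseg : ∀ x : X, #{y // y ≤ x} ≤ #(μ.out) := by
      intro x
      have h1 : #{y // r y x} < #X := by
        have := card_typein_lt (r := r) x hrX
        exact this
      have h2 : #{y // r y x} ≤ μ := Order.lt_succ_iff.1 (h1.trans_le hX)
      have h3 : {y | y ≤ x} ⊆ {y | r y x} ∪ {x} := by
        intro y hy
        rcases (show y ≤ x from hy).lt_or_eq with h | h
        · exact Or.inl h
        · exact Or.inr h
      rw [mk_out]
      calc #{y // y ≤ x} ≤ #(({y | r y x} ∪ {x} : Set X)) := mk_le_mk_of_subset h3
        _ ≤ #({y | r y x}) + #({x} : Set X) := mk_union_le _ _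
        _ ≤ μ + μ := add_le_add h2 ((mk_le_aleph0).trans hμ0)
        _ = μ := add_eq_self hμ0
    have hemb : ∀ x : X, ∃ e : X → μ.out, Set.InjOn e {y | y ≤ x} := by
      intro x
      obtain ⟨f⟩ := hseg x
      refine ⟨fun y => if h : y ≤ x then f ⟨y, h⟩ else f ⟨x, le_rfl⟩, ?_⟩
      intro y hy z hz h
      simp only [Set.mem_ofPred_eq] at hy hz
      simp only [hy, hz, dif_pos] at h
      exact congrArg Subtype.val (f.injective h)
    choose e he using hemb
    have hmax : ∀ x : Fin d → X, ∃ i, ∀ j, x j ≤ x i := fun x => Finite.exists_max x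
    choose m hm using hmax
    refine ⟨Fin d × C, fun x => (m x, c fun j => e (x (m x)) (x j)),
      fun a => insert a.1 (I a.2), ?_, ?_, ?_⟩
    · rw [mk_prod, lift_id, lift_id]
      exact (mul_le_mul' ((mk_le_aleph0).trans hκ) hC).trans (mul_eq_self hκ).le
    · exact fun a => (Finset.card_insert_le _ _).trans (Nat.add_le_add_right (hI _) 1)
    · intro x y h hxy
      obtain ⟨h1, h2⟩ := Prod.ext_iff.1 h
      simp only at h1 h2 hxy
      have h3 : x (m x) = y (m y) := h1 ▸ hxy (m x) (Finset.mem_insert_self _ _)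
      rw [← h3] at h2
      have := hc _ _ h2 fun i hi => by rw [hxy i (Finset.mem_insert_of_mem hi)]
      funext j
      exact he _ (hm x j) (by simpa [h3] using hm y j) (congrFun this j)

/-- A polarized partition relation: every coloring of `X ^ d` with few colors is constant on a
finite grid, nondegenerate in the directions of `I`. -/
theorem exists_monochromatic_grid {κ : Cardinal.{0}} (hκ : ℵ₀ ≤ κ) {d : ℕ} (S : Type) [Finite S]
    (I : Finset (Fin d)) : ∀ (X C : Type), Order.succ^[I.card] κ ≤ #X → #C ≤ κ →
      ∀ φ : (Fin d → X) → C, ∃ h : Fin d → S → X, (∀ i ∈ I, Function.Injective (h i)) ∧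
        ∃ c, ∀ u : Fin d → S, φ (fun i => h i (u i)) = c := by
  classical
  induction I using Finset.induction_on with
  | empty =>
    intro X C hX _ φ
    have : Nonempty X := by
      rw [← mk_ne_zero_iff]
      rintro h
      rw [h] at hX
      simp at hX
      exact absurd (hκ.trans hX.le) (not_le.2 aleph0_pos)
    exact ⟨fun _ _ => Classical.arbitrary X, by simp, _, fun u => rfl⟩
  | insert i I hi ih =>
    intro X C hX hC φ
    rw [Finset.card_insert_of_notMem hi, Function.iterate_succ_apply'] at hX
    set μ := Order.succ^[I.card] κ with hμ
    have hμ0 : ℵ₀ ≤ μ := hκ.trans (κ.le_succ_iterate _)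
    obtain ⟨X', hX'⟩ := le_mk_iff_exists_set.1 ((Order.le_succ μ).trans hX)
    have key := fun y : X => ih X' C hX'.ge hC fun u => φ (Function.update (fun j => (u j : X)) i y)
    choose h hinj c hc using key
    have hlt : #((Fin d → S → X') × C) < #X := by
      refine lt_of_le_of_lt ?_ (Order.succ_le_iff.1 hX)
      rw [mk_prod, lift_id, lift_id]
      refine (mul_le_mul' ?_ (hC.trans (κ.le_succ_iterate _))).trans (mul_eq_self hμ0).le
      have : #(Fin d → S → X') = #(Fin d × S → X') := mk_congr (Equiv.curry _ _ _).symm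
      rw [this, ← Cardinal.power_def, hX']
      have : Fintype (Fin d × S) := Fintype.ofFinite _
      rw [mk_fintype]
      exact power_nat_le hμ0
    have : Infinite X := infinite_iff.2 (hμ0.trans ((Order.le_succ μ).trans hX))
    obtain ⟨⟨g, a⟩, hfib⟩ := exists_infinite_fiber (fun y => (h y, c y)) hlt
    have : Fintype S := Fintype.ofFinite _
    obtain ⟨s⟩ : Nonempty (S ↪ ((fun y => (h y, c y)) ⁻¹' {(g, a)})) := by
      rw [← Cardinal.le_def]
      exact (mk_le_aleph0).trans (aleph0_le_mk _)
    have hs : ∀ z, h (s z) = g ∧ c (s z) = a := fun z => Prod.ext_iff.1 (s z).2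
    refine ⟨Function.update (fun j z => (g j z : X)) i fun z => (s z : X), ?_, a, ?_⟩
    · intro j hj
      rcases eq_or_ne j i with rfl | hji
      · rw [Function.update_self]
        exact Subtype.val_injective.comp s.injective
      · rw [Function.update_of_ne hji]
        rcases isEmpty_or_nonempty S with hS | ⟨⟨z⟩⟩
        · exact Function.injective_of_subsingleton _
        · rw [← (hs z).1]
          exact Subtype.val_injective.comp
            (hinj (s z) j ((Finset.mem_insert.1 hj).resolve_left hji))
    · intro u
      refine Eq.trans ?_ ((hc (s (u i)) u).trans (hs (u i)).2)
      congr 1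
      funext j
      rcases eq_or_ne j i with rfl | hji
      · simp
      · simp [Function.update_of_ne hji, (hs (u i)).1]

end PartitionRelations

section Support

open MvPolynomial

theorem MvPolynomial.totalDegree_pderiv_lt {σ K : Type*} [CommRing K] {f : MvPolynomial σ K} {v : σ}
    (h : pderiv v f ≠ 0) : (pderiv v f).totalDegree < f.totalDegree := by
  classical
  obtain ⟨m, hm, hmd⟩ := Finset.exists_mem_eq_sup (pderiv v f).support (support_nonempty.2 h)
    (fun s => s.sum fun _ e => e)
  have h1 : m + Finsupp.single v 1 ∈ f.support := by
    rw [mem_support_iff] at hm ⊢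
    rw [coeff_pderiv] at hm
    exact left_ne_zero_of_mul hm
  have h2 := le_totalDegree h1
  rw [Finsupp.sum_add_index' (by simp) (by simp), Finsupp.sum_single_index rfl] at h2
  rw [totalDegree, hmd]
  omega

theorem MvPolynomial.notMem_vars_of_pderiv_eq_zero {σ K : Type*} [Field K] [CharZero K]
    {f : MvPolynomial σ K} {v : σ} (h : pderiv v f = 0) : v ∉ f.vars := by
  classical
  rw [mem_vars_iff_mem_support]
  rintro ⟨m, hm, hv⟩
  rw [Finsupp.mem_support_iff] at hv
  have h1 := congrArg (coeff (m - Finsupp.single v 1)) h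
  rw [coeff_pderiv, tsub_add_cancel_of_le (Finsupp.single_le_iff.2 (Nat.one_le_iff_ne_zero.2 hv)),
    coeff_zero] at h1
  refine mul_ne_zero (mem_support_iff.1 hm) ?_ h1
  exact Nat.cast_add_one_ne_zero _

/-- Evaluation of a polynomial whose variable `none` is a distinguished dependent variable. -/
noncomputable def evalParam {d : ℕ} {K L : Type*} [CommRing K] [CommRing L] [Algebra K L]
    (f : MvPolynomial (Option (Fin d)) K) (s : Fin d → L) (y : L) : L :=
  aeval (fun o : Option (Fin d) => o.elim y s) f

/-- The tuple `a` is a simple solution over `s` of the triangular system `f`. -/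
def IsSimpleSol {d n : ℕ} {K L : Type*} [CommRing K] [CommRing L] [Algebra K L]
    (f : Fin n → MvPolynomial (Option (Fin d)) K) (s : Fin d → L) (a : Fin n → L) : Prop :=
  ∀ l, evalParam (f l) s (a l) = 0 ∧ evalParam (pderiv none (f l)) s (a l) ≠ 0

/-- Every parameter of the system `f` matters for the solution `a`. -/
def IsFullySupported {d n : ℕ} {K L : Type*} [CommRing K] [CommRing L] [Algebra K L]
    (f : Fin n → MvPolynomial (Option (Fin d)) K) (s : Fin d → L) (a : Fin n → L) : Prop :=
  ∀ j, ∃ l, evalParam (pderiv (some j) (f l)) s (a l) ≠ 0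

theorem exists_finite_parameters {n : ℕ} {K R : Type*} [Field K] [Field R] [Algebra K R]
    {T : Set R} (hT : IsTranscendenceBasis K ((↑) : T → R)) (a : Fin n → R) :
    ∃ (d : ℕ) (s : Fin d → R), Function.Injective s ∧ (∀ j, s j ∈ T) ∧
      ∃ f : Fin n → MvPolynomial (Option (Fin d)) K, ∀ l, f l ≠ 0 ∧ evalParam (f l) s (a l) = 0 := by
  classical
  have h1 : ∀ l, ∃ g : MvPolynomial (Option T) K, g ≠ 0 ∧
      aeval (fun o : Option T => o.elim (a l) (fun t => (t : R))) g = 0 := by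
    intro l
    have h2 : ¬ AlgebraicIndependent K (fun o : Option T => o.elim (a l) (fun t => (t : R))) := by
      rw [hT.1.option_iff_transcendental]
      have := hT.isAlgebraic
      rw [Subtype.range_coe] at this
      rw [Transcendental, not_not, Subtype.range_coe]
      exact this.isAlgebraic _
    rw [algebraicIndependent_iff] at h2
    push Not at h2
    obtain ⟨g, hg, hg0⟩ := h2
    exact ⟨g, hg0, hg⟩
  choose g hg0 hg using h1
  let U : Finset T := (Finset.univ.biUnion fun l => (g l).vars).eraseNone
  let s : Fin U.card → T := fun j => U.equivFin.symm j
  have hs : Function.Injective s := Subtype.val_injective.comp U.equivFin.symm.injective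
  have h2 : ∀ l, ∃ q : MvPolynomial (Option (Fin U.card)) K, rename (Option.map s) q = g l := by
    intro l
    refine exists_rename_eq_of_vars_subset_range _ _ (Option.map_injective hs) ?_
    rintro (_ | t) ht
    · exact ⟨none, rfl⟩
    · have : t ∈ U := by
        simp only [U, Finset.mem_eraseNone, Finset.mem_biUnion, Finset.mem_univ, true_and]
        exact ⟨l, ht⟩
      exact ⟨some (U.equivFin ⟨t, this⟩), by simp [s]⟩
  choose f hf using h2
  refine ⟨U.card, fun j => (s j : R), Subtype.val_injective.comp hs, fun j => (s j).2, f,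
    fun l => ⟨?_, ?_⟩⟩
  · rintro h
    exact hg0 l (by rw [← hf l, h, map_zero])
  · have := hg l
    rw [← hf l, aeval_rename] at this
    rw [evalParam, ← this]
    congr 2
    funext o
    cases o <;> rfl

theorem exists_simpleSol {n : ℕ} {K R : Type*} [Field K] [CharZero K] [Field R] [Algebra K R]
    {T : Set R} (hT : IsTranscendenceBasis K ((↑) : T → R)) (a : Fin n → R) :
    ∃ (d : ℕ) (s : Fin d → R), Function.Injective s ∧ (∀ j, s j ∈ T) ∧
      ∃ f : Fin n → MvPolynomial (Option (Fin d)) K,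
        IsSimpleSol f s a ∧ IsFullySupported f s a := by
  classical
  have hleast : ∀ {Q : ℕ → Prop}, (∃ d, Q d) → ∃ d, Q d ∧ ∀ m < d, ¬ Q m := fun h =>
    ⟨Nat.find h, Nat.find_spec h, fun m => Nat.find_min h⟩
  obtain ⟨d, ⟨s, hs, hsT, f₀, hf₀⟩, hmin⟩ := hleast (exists_finite_parameters hT a)
  have h1 : ∀ l, ∃ f : MvPolynomial (Option (Fin d)) K, (f ≠ 0 ∧ evalParam f s (a l) = 0) ∧
      ∀ g : MvPolynomial (Option (Fin d)) K, g ≠ 0 ∧ evalParam g s (a l) = 0 →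
        f.totalDegree ≤ g.totalDegree := by
    intro l
    obtain ⟨f, hf, hmin⟩ := (measure totalDegree).wf.has_min
      {g : MvPolynomial (Option (Fin d)) K | g ≠ 0 ∧ evalParam g s (a l) = 0} ⟨f₀ l, hf₀ l⟩
    exact ⟨f, hf, fun g hg => not_lt.1 (hmin g hg)⟩
  choose f hf hfmin using h1
  have hvar : ∀ l v, evalParam (pderiv v (f l)) s (a l) = 0 → v ∉ (f l).vars := by
    intro l v h
    refine notMem_vars_of_pderiv_eq_zero ?_
    by_contra h0
    exact absurd (hfmin l _ ⟨h0, h⟩) (not_le.2 (totalDegree_pderiv_lt h0))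
  refine ⟨d, s, hs, hsT, f, fun l => ⟨(hf l).2, fun h => ?_⟩, fun j => ?_⟩
  · obtain ⟨q, hq⟩ := exists_rename_eq_of_vars_subset_range (f l) (some : Fin d → _)
      (Option.some_injective _) (by
        rintro (_ | t) ht
        · exact absurd ht (hvar l _ h)
        · exact ⟨t, rfl⟩)
    have h2 := (hf l).2
    rw [evalParam, ← hq, aeval_rename] at h2
    have h3 : AlgebraicIndependent K s :=
      hT.1.comp (fun j => ⟨s j, hsT j⟩) fun i j h => hs (congrArg Subtype.val h)
    have h4 : q = 0 := (algebraicIndependent_iff.1 h3) q h2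
    exact (hf l).1 (by rw [← hq, h4, map_zero])
  · by_contra! h
    have hd : 0 < d := j.pos
    obtain ⟨d', hd'⟩ : ∃ d', d = d' + 1 := ⟨d - 1, by omega⟩
    subst hd'
    have h2 : ∀ l, ∃ q, rename (Option.map j.succAbove) q = f l := fun l => by
      refine exists_rename_eq_of_vars_subset_range _ _
        (Option.map_injective Fin.succAbove_right_injective) ?_
      rintro (_ | t) ht
      · exact ⟨none, rfl⟩
      · have : t ≠ j := by
          rintro rfl
          exact hvar l _ (h l) ht
        obtain ⟨z, rfl⟩ := Fin.exists_succAbove_eq this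
        exact ⟨some z, rfl⟩
    choose q hq using h2
    refine hmin d' (Nat.lt_succ_self _) ⟨s ∘ j.succAbove, hs.comp Fin.succAbove_right_injective,
      fun i => hsT _, q, fun l => ⟨?_, ?_⟩⟩
    · rintro h0
      exact (hf l).1 (by rw [← hq l, h0, map_zero])
    · have := (hf l).2
      rw [← hq l, evalParam, aeval_rename] at this
      rw [evalParam, ← this]
      congr 2
      funext o
      cases o <;> rfl

end Support

section Flow

open MvPolynomial

section ChainRule

variable {σ K : Type*} [Fintype σ] [CommRing K]

theorem Derivation.map_mvPolynomial_aeval {L : Type*} [CommRing L] [Algebra K L]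
    (D : Derivation K L L) (v : σ → L) (h : MvPolynomial σ K) :
    D (aeval v h) = ∑ i, aeval v (pderiv i h) * D (v i) := by
  classical
  induction h using MvPolynomial.induction_on with
  | C a => simp
  | add p q hp hq => simp [hp, hq, add_mul, Finset.sum_add_distrib]
  | mul_X p i hp =>
    simp only [map_mul, aeval_X, Derivation.leibniz, smul_eq_mul, hp, map_add, pderiv_X, add_mul,
      Finset.sum_add_distrib, Finset.mul_sum]
    congr 1
    · rw [Finset.sum_eq_single i]
      · simp
      · intro b _ hb
        simp [hb.symm]
      · simp
    · exact Finset.sum_congr rfl fun j _ => by ring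

theorem MvPolynomial.mkDerivation_eq_sum (u : σ → MvPolynomial σ K) (h : MvPolynomial σ K) :
    mkDerivation K u h = ∑ v, pderiv v h * u v := by
  have := (mkDerivation K u).map_mvPolynomial_aeval X h
  simpa only [aeval_X_left_apply, mkDerivation_X] using this

theorem MvPolynomial.hasDerivAt_aeval [Algebra K ℂ] {γ : ℝ → σ → ℂ} {γ' : σ → ℂ} {t : ℝ}
    (hγ : ∀ i, HasDerivAt (fun t => γ t i) (γ' i) t) (h : MvPolynomial σ K) :
    HasDerivAt (fun t => aeval (γ t) h) (∑ i, aeval (γ t) (pderiv i h) * γ' i) t := by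
  classical
  induction h using MvPolynomial.induction_on with
  | C a => simpa using hasDerivAt_const t _
  | add p q hp hq =>
    simp only [map_add, add_mul, Finset.sum_add_distrib]
    exact hp.add hq
  | mul_X p i hp =>
    simp only [map_mul, aeval_X]
    refine (hp.mul (hγ i)).congr_deriv ?_
    simp only [Derivation.leibniz, smul_eq_mul, map_add, map_mul, aeval_X, pderiv_X, add_mul,
      Finset.sum_add_distrib, Finset.sum_mul]
    rw [add_comm]
    congr 1
    · rw [Finset.sum_eq_single i]
      · simp
      · intro b _ hb
        simp [hb.symm]
      · simp
    · exact Finset.sum_congr rfl fun j _ => by ring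

theorem Derivation.map_aeval_of_eq_mul {L : Type*} [CommRing L] [Algebra K L]
    (D : Derivation K L L) {v : σ → L} {c : L} {u : σ → MvPolynomial σ K}
    (hv : ∀ i, D (v i) = c * aeval v (u i)) (h : MvPolynomial σ K) :
    D (aeval v h) = c * aeval v (mkDerivation K u h) := by
  rw [D.map_mvPolynomial_aeval, mkDerivation_eq_sum, map_sum, Finset.mul_sum]
  refine Finset.sum_congr rfl fun i _ => ?_
  rw [hv, map_mul]
  ring

theorem Derivation.aeval_iterate_eq_zero {L : Type*} [Field L] [Algebra K L]
    (D : Derivation K L L) {v : σ → L} {c : L} (hc : c ≠ 0) {u : σ → MvPolynomial σ K}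
    (hv : ∀ i, D (v i) = c * aeval v (u i)) {h : MvPolynomial σ K} (h0 : aeval v h = 0) (r : ℕ) :
    aeval v ((mkDerivation K u)^[r] h) = 0 := by
  induction r with
  | zero => exact h0
  | succ r ih =>
    rw [Function.iterate_succ_apply']
    have := D.map_aeval_of_eq_mul hv ((mkDerivation K u)^[r] h)
    rw [ih, map_zero, eq_comm] at this
    exact (mul_eq_zero.1 this).resolve_left hc

theorem MvPolynomial.hasDerivAt_aeval_of_eq_mul [Algebra K ℂ] {γ : ℝ → σ → ℂ} {c : ℂ} {t : ℝ}
    {u : σ → MvPolynomial σ K}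
    (hγ : ∀ i, HasDerivAt (fun t => γ t i) (c * aeval (γ t) (u i)) t) (h : MvPolynomial σ K) :
    HasDerivAt (fun t => aeval (γ t) h) (c * aeval (γ t) (mkDerivation K u h)) t := by
  refine (hasDerivAt_aeval hγ h).congr_deriv ?_
  rw [mkDerivation_eq_sum, map_sum, Finset.mul_sum]
  refine Finset.sum_congr rfl fun i _ => ?_
  rw [map_mul]
  ring

end ChainRule

theorem Submodule.exists_mem_span_image_Iio {A : Type*} [CommRing A] [IsNoetherianRing A]
    (w : ℕ → A) : ∃ N, ∃ c : Fin N → A, w N = ∑ r, c r * w r := by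
  let I : ℕ →o Ideal A := ⟨fun N => Ideal.span (Set.range fun r : Fin N => w r), fun M N h =>
    Ideal.span_mono (by rintro _ ⟨r, rfl⟩; exact ⟨r.castLE h, rfl⟩)⟩
  obtain ⟨N, hN⟩ := monotone_stabilizes_iff_noetherian.2 (inferInstanceAs (IsNoetherian A A)) I
  have h1 : w N ∈ I N := by
    rw [hN (N + 1) N.le_succ]
    exact Ideal.subset_span ⟨Fin.last N, rfl⟩
  obtain ⟨c, hc⟩ := (Submodule.mem_span_range_iff_exists_fun A).1 h1
  exact ⟨N, c, by simpa using hc.symm⟩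

/-- If a polynomial and all its iterated derivatives along a polynomial vector field vanish at the
start of an integral curve (up to time change), it vanishes along the curve. -/
theorem MvPolynomial.aeval_eq_zero_of_flow {σ K : Type*} [Fintype σ] [Field K] [Algebra K ℂ]
    {γ : ℝ → σ → ℂ} {c : ℝ → ℂ} {u : σ → MvPolynomial σ K}
    (hγ : ∀ t ∈ Set.Icc (0 : ℝ) 1, ∀ i, HasDerivAt (fun t => γ t i) (c t * aeval (γ t) (u i)) t)
    (hc : ContinuousOn c (Set.Icc 0 1)) {h : MvPolynomial σ K}
    (h0 : ∀ r, aeval (γ 0) ((mkDerivation K u)^[r] h) = 0) : aeval (γ 1) h = 0 := by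
  set D := mkDerivation K u
  obtain ⟨N, b, hb⟩ := Submodule.exists_mem_span_image_Iio fun r => D^[r] h
  have hder : ∀ t ∈ Set.Icc (0 : ℝ) 1, ∀ g : MvPolynomial σ K,
      HasDerivAt (fun t => aeval (γ t) g) (c t * aeval (γ t) (D g)) t :=
    fun t ht g => hasDerivAt_aeval_of_eq_mul (hγ t ht) g
  have hcont : ∀ g : MvPolynomial σ K, ContinuousOn (fun t => aeval (γ t) g) (Set.Icc 0 1) :=
    fun g t ht => (hder t ht g).continuousAt.continuousWithinAt
  rcases Nat.eq_zero_or_pos N with rfl | hN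
  · have : h = 0 := by simpa using hb
    rw [this, map_zero]
  let Y : ℝ → Fin N → ℂ := fun t r => aeval (γ t) (D^[r] h)
  let Y' : ℝ → Fin N → ℂ := fun t r => c t * aeval (γ t) (D (D^[r] h))
  have hY : ∀ t ∈ Set.Icc (0 : ℝ) 1, HasDerivAt Y (Y' t) t := fun t ht =>
    hasDerivAt_pi.2 fun r => hder t ht _
  obtain ⟨M, hM⟩ := isCompact_Icc.exists_bound_of_continuousOn
    (f := fun t => ‖c t‖ * (1 + ∑ i, ‖aeval (γ t) (b i)‖))
    (hc.norm.mul (continuousOn_const.add (continuousOn_finsetSum _ fun i _ => (hcont (b i)).norm)))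
  have hbound : ∀ t ∈ Set.Icc (0 : ℝ) 1, ‖Y' t‖ ≤ M * ‖Y t‖ := by
    intro t ht
    have hMt := (le_abs_self _).trans (hM t ht)
    refine le_trans ?_ (mul_le_mul_of_nonneg_right hMt (norm_nonneg _))
    refine (pi_norm_le_iff_of_nonneg (by positivity)).2 fun r => ?_
    simp only [Y', norm_mul]
    rw [mul_assoc]
    refine mul_le_mul_of_nonneg_left ?_ (norm_nonneg _)
    rw [← Function.iterate_succ_apply' D]
    rcases (Nat.succ_le_of_lt r.2).lt_or_eq with h1 | h1
    · calc ‖aeval (γ t) (D^[r + 1] h)‖ ≤ ‖Y t‖ := norm_le_pi_norm (Y t) ⟨r + 1, h1⟩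
        _ ≤ _ := le_mul_of_one_le_left (norm_nonneg _)
          (le_add_of_nonneg_right (Finset.sum_nonneg fun _ _ => norm_nonneg _))
    · rw [h1, hb, map_sum, add_mul, Finset.sum_mul]
      refine (norm_sum_le _ _).trans (le_add_of_nonneg_of_le (by positivity)
        (Finset.sum_le_sum fun i _ => ?_))
      rw [map_mul, norm_mul]
      exact mul_le_mul_of_nonneg_left (norm_le_pi_norm (Y t) i) (norm_nonneg _)
  have hg := norm_le_gronwallBound_of_norm_deriv_right_le (f := Y) (f' := Y') (δ := 0) (K := M)
    (ε := 0) (a := 0) (b := 1) (fun t ht => (hY t ht).continuousAt.continuousWithinAt)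
    (fun t ht => (hY t (Set.Ico_subset_Icc_self ht)).hasDerivWithinAt)
    (by
      have : Y 0 = 0 := by funext r; exact h0 r
      simp [this])
    (fun t ht => by simpa using hbound t (Set.Ico_subset_Icc_self ht)) 1 (by simp)
  rw [gronwallBound_ε0_δ0] at hg
  have := congrFun (norm_le_zero_iff.1 hg) ⟨0, hN⟩
  exact this

end Flow

section EtaleSystems

open MvPolynomial

section System

variable {k d n : ℕ} {K L : Type*} [Field K] [Field L] [Algebra K L]

/-- The point of `(L^d × L^n)^k` with the given coordinates. -/
def sysPoint (x : Fin k → Fin d → L) (y : Fin k → Fin n → L) : Fin k × (Fin d ⊕ Fin n) → L :=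
  fun v => Sum.elim (x v.1) (y v.1) v.2

/-- The variables occurring in the `l`-th equation of the `i`-th copy of a system. -/
def sysVar (i : Fin k) (l : Fin n) : Option (Fin d) → Fin k × (Fin d ⊕ Fin n) :=
  fun o => (i, o.elim (Sum.inr l) Sum.inl)

theorem aeval_sysPoint_rename (x : Fin k → Fin d → L) (y : Fin k → Fin n → L) (i : Fin k)
    (l : Fin n) (g : MvPolynomial (Option (Fin d)) K) :
    aeval (sysPoint x y) (rename (sysVar i l) g) = evalParam g (x i) (y i l) := by
  rw [aeval_rename, evalParam]
  congr 2
  funext o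
  cases o <;> rfl

/-- The polynomial vector field lifting the constant vector field `η` to the solutions of the
system `f`, after multiplication by the product of the separants. -/
noncomputable def sysField (f : Fin n → MvPolynomial (Option (Fin d)) K) (η : Fin k → Fin d → ℚ) :
    Fin k × (Fin d ⊕ Fin n) → MvPolynomial (Fin k × (Fin d ⊕ Fin n)) K :=
  fun v => Sum.elim
    (fun j => C (η v.1 j : K) *
      ∏ p : Fin k × Fin n, rename (sysVar p.1 p.2) (pderiv none (f p.2)))
    (fun l => -(∏ p ∈ Finset.univ.erase (v.1, l),
        rename (sysVar p.1 p.2) (pderiv none (f p.2))) *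
      ∑ j, rename (sysVar v.1 l) (pderiv (some j) (f l)) * C (η v.1 j : K)) v.2

/-- The product of the separants of the system at a point. -/
noncomputable def separant (f : Fin n → MvPolynomial (Option (Fin d)) K) (x : Fin k → Fin d → L)
    (y : Fin k → Fin n → L) : L :=
  ∏ p : Fin k × Fin n, evalParam (pderiv none (f p.2)) (x p.1) (y p.1 p.2)

/-- The implicit derivative at a simple solution. -/
noncomputable def implicitDer (g : MvPolynomial (Option (Fin d)) K) (s : Fin d → L) (y : L)
    (ξ : Fin d → L) : L :=
  -(∑ j, evalParam (pderiv (some j) g) s y * ξ j) / evalParam (pderiv none g) s y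

variable {f : Fin n → MvPolynomial (Option (Fin d)) K} {x : Fin k → Fin d → L}
  {y : Fin k → Fin n → L}

theorem separant_ne_zero (h : ∀ i, IsSimpleSol f (x i) (y i)) : separant f x y ≠ 0 :=
  Finset.prod_ne_zero_iff.2 fun p _ => (h p.1 p.2).2

theorem sysField_inl [CharZero K] [CharZero L] (η : Fin k → Fin d → ℚ)
    (h : ∀ i, IsSimpleSol f (x i) (y i)) (i : Fin k) (j : Fin d) :
    (separant f x y)⁻¹ * aeval (sysPoint x y) (sysField f η (i, Sum.inl j)) = η i j := by
  have h0 := separant_ne_zero h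
  simp only [sysField, Sum.elim_inl, map_mul, map_prod, aeval_sysPoint_rename, aeval_C,
    map_ratCast]
  change _ * (_ * separant f x y) = _
  field_simp

theorem sysField_inr [CharZero K] [CharZero L] (η : Fin k → Fin d → ℚ)
    (h : ∀ i, IsSimpleSol f (x i) (y i)) (i : Fin k) (l : Fin n) :
    (separant f x y)⁻¹ * aeval (sysPoint x y) (sysField f η (i, Sum.inr l)) =
      implicitDer (f l) (x i) (y i l) (fun j => (η i j : L)) := by
  have h0 := separant_ne_zero h
  have h1 := (h i l).2
  have h2 : separant f x y = evalParam (pderiv none (f l)) (x i) (y i l) *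
      ∏ p ∈ Finset.univ.erase (i, l), evalParam (pderiv none (f p.2)) (x p.1) (y p.1 p.2) :=
    (Finset.mul_prod_erase Finset.univ
      (fun p : Fin k × Fin n => evalParam (pderiv none (f p.2)) (x p.1) (y p.1 p.2))
      (Finset.mem_univ (i, l))).symm
  simp only [sysField, Sum.elim_inr, map_mul, map_prod, map_neg, map_sum, aeval_sysPoint_rename,
    aeval_C, map_ratCast, implicitDer]
  rw [h2] at h0 ⊢
  have h3 := right_ne_zero_of_mul h0
  field_simp

theorem Derivation.eq_implicitDer (D : Derivation K L L) {g : MvPolynomial (Option (Fin d)) K}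
    {s : Fin d → L} {w : L} (h0 : evalParam g s w = 0) (h1 : evalParam (pderiv none g) s w ≠ 0) :
    D w = implicitDer g s w fun j => D (s j) := by
  have h := D.map_mvPolynomial_aeval (fun o : Option (Fin d) => o.elim w s) g
  rw [show aeval (fun o : Option (Fin d) => o.elim w s) g = 0 from h0, map_zero,
    Fintype.sum_option] at h
  simp only [Option.elim] at h
  rw [implicitDer, eq_div_iff h1, eq_neg_iff_add_eq_zero, mul_comm]
  exact h.symm

theorem hasDerivAt_eq_implicitDer [Algebra K ℂ] {g : MvPolynomial (Option (Fin d)) K}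
    {s : ℝ → Fin d → ℂ} {w : ℝ → ℂ} {s' : Fin d → ℂ} {w' : ℂ} {t : ℝ}
    (hs : ∀ j, HasDerivAt (fun t => s t j) (s' j) t) (hw : HasDerivAt w w' t)
    (h0 : ∀ᶠ t in nhds t, evalParam g (s t) (w t) = 0)
    (h1 : evalParam (pderiv none g) (s t) (w t) ≠ 0) : w' = implicitDer g (s t) (w t) s' := by
  have h := hasDerivAt_aeval (γ := fun t (o : Option (Fin d)) => o.elim (w t) (s t))
    (γ' := fun o => o.elim w' s') (t := t) (by rintro (_ | j); exacts [hw, hs j]) g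
  have h2 : HasDerivAt (fun t => evalParam g (s t) (w t)) 0 t :=
    (hasDerivAt_const t (0 : ℂ)).congr_of_eventuallyEq h0
  have h3 := h.unique h2
  rw [Fintype.sum_option] at h3
  simp only [Option.elim] at h3
  rw [implicitDer, eq_div_iff h1, eq_neg_iff_add_eq_zero, mul_comm]
  exact h3

theorem Derivation.aeval_sysField_iterate_eq_zero [CharZero K] [CharZero L] {η : Fin k → Fin d → ℚ}
    (h : ∀ i, IsSimpleSol f (x i) (y i)) (D : Derivation K L L)
    (hD : ∀ i j, D (x i j) = η i j) {q : MvPolynomial (Fin k × (Fin d ⊕ Fin n)) K}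
    (hq : aeval (sysPoint x y) q = 0) (r : ℕ) :
    aeval (sysPoint x y) ((mkDerivation K (sysField f η))^[r] q) = 0 := by
  refine D.aeval_iterate_eq_zero (inv_ne_zero (separant_ne_zero h)) ?_ hq r
  rintro ⟨i, j | l⟩
  · rw [sysField_inl η h]
    exact hD i j
  · rw [sysField_inr η h]
    simp only [← hD]
    exact D.eq_implicitDer (h i l).1 (h i l).2

end System

/-- `F` is a differentiable branch of simple solutions of the system `f` over the open set `B`. -/
structure IsBranch {d n : ℕ} {K : Type*} [Field K] [Algebra K ℂ]
    (f : Fin n → MvPolynomial (Option (Fin d)) K) (B : Set (Fin d → ℝ))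
    (F : (Fin d → ℝ) → Fin n → ℂ) : Prop where
  isOpen : IsOpen B
  differentiableAt : ∀ x ∈ B, DifferentiableAt ℝ F x
  isSimpleSol : ∀ x ∈ B, IsSimpleSol f (fun j => (x j : ℂ)) (F x)

namespace IsBranch

variable {k d n : ℕ} {K : Type*} [Field K] [CharZero K] [Algebra K ℂ]
  {f : Fin n → MvPolynomial (Option (Fin d)) K} {B : Set (Fin d → ℝ)}
  {F : (Fin d → ℝ) → Fin n → ℂ}

/-- The point of the `k`-fold solution space above `x`. -/
def point (F : (Fin d → ℝ) → Fin n → ℂ) (x : Fin k → Fin d → ℝ) :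
    Fin k × (Fin d ⊕ Fin n) → ℂ :=
  sysPoint (fun i j => (x i j : ℂ)) (fun i => F (x i))

theorem hasDerivAt_point (hF : IsBranch f B F) (x : Fin k → Fin d → ℝ) (η : Fin k → Fin d → ℚ)
    (t : ℝ) (ht : ∀ i, (fun j => x i j + t * η i j) ∈ B) (v : Fin k × (Fin d ⊕ Fin n)) :
    HasDerivAt (fun t : ℝ => point F (fun i j => x i j + t * η i j) v)
      ((separant f (fun i j => ((x i j + t * η i j : ℝ) : ℂ))
        (fun i => F (fun j => x i j + t * η i j)))⁻¹ *
        aeval (point F (fun i j => x i j + t * η i j)) (sysField f η v)) t := by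
  have hsol : ∀ i, IsSimpleSol f (fun j => ((x i j + t * η i j : ℝ) : ℂ))
      (F (fun j => x i j + t * η i j)) := fun i => hF.isSimpleSol _ (ht i)
  have hlin : ∀ i j, HasDerivAt (fun t : ℝ => x i j + t * η i j) (η i j) t := fun i j => by
    simpa using ((hasDerivAt_id t).mul_const (η i j : ℝ)).const_add (x i j)
  have hlinC : ∀ i j, HasDerivAt (fun t : ℝ => ((x i j + t * η i j : ℝ) : ℂ)) (η i j : ℂ) t :=
    fun i j => by simpa using (hlin i j).ofReal_comp
  rcases v with ⟨i, j | l⟩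
  · rw [point, sysField_inl η hsol]
    exact hlinC i j
  · rw [point, sysField_inr η hsol]
    have hcurve : HasDerivAt (fun t : ℝ => fun j => x i j + t * η i j) (fun j => (η i j : ℝ)) t :=
      hasDerivAt_pi.2 (hlin i)
    have hd : DifferentiableAt ℝ (fun t : ℝ => F (fun j => x i j + t * η i j) l) t :=
      DifferentiableAt.comp (g := fun z => F z l) (f := fun t : ℝ => fun j => x i j + t * η i j) t
        (differentiableAt_pi.1 (hF.differentiableAt _ (ht i)) l) hcurve.differentiableAt
    have hzero : ∀ᶠ z : ℝ in nhds t, evalParam (f l) (fun j => ((x i j + z * η i j : ℝ) : ℂ))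
        (F (fun j => x i j + z * η i j) l) = 0 := by
      filter_upwards [hcurve.continuousAt.preimage_mem_nhds (hF.isOpen.mem_nhds (ht i))] with z hz
      exact (hF.isSimpleSol _ hz l).1
    have h := hasDerivAt_eq_implicitDer (g := f l) (t := t)
      (s := fun t j => ((x i j + t * η i j : ℝ) : ℂ))
      (w := fun t => F (fun j => x i j + t * η i j) l) (hlinC i) hd.hasDerivAt hzero (hsol i l).2
    exact hd.hasDerivAt.congr_deriv h

theorem aeval_eq_zero_of_segment (hF : IsBranch f B F) (x : Fin k → Fin d → ℝ)
    (η : Fin k → Fin d → ℚ)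
    (hx : ∀ t ∈ Set.Icc (0 : ℝ) 1, ∀ i, (fun j => x i j + t * η i j) ∈ B)
    {q : MvPolynomial (Fin k × (Fin d ⊕ Fin n)) K}
    (hq : ∀ r, aeval (point F x) ((mkDerivation K (sysField f η))^[r] q) = 0) :
    aeval (point F fun i j => x i j + η i j) q = 0 := by
  have h := aeval_eq_zero_of_flow (γ := fun t => point F fun i j => x i j + t * η i j)
    (fun t ht v => hF.hasDerivAt_point x η t (hx t ht) v) ?_ (h := q) (by simpa using hq)
  · simpa using h
  · refine ContinuousOn.inv₀ ?_ fun t ht => separant_ne_zero fun i => hF.isSimpleSol _ (hx t ht i)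
    refine continuousOn_finsetProd _ fun p _ => ?_
    intro t ht
    have h1 := hasDerivAt_aeval_of_eq_mul (hF.hasDerivAt_point x η t (hx t ht))
      (rename (sysVar p.1 p.2) (pderiv none (f p.2)))
    have h2 := h1.continuousAt.continuousWithinAt (s := Set.Icc 0 1)
    simpa only [point, aeval_sysPoint_rename] using h2

theorem iterate_eq_zero (hF : IsBranch f B F) (x : Fin k → Fin d → ℝ)
    (hx : ∀ i, x i ∈ B) (η : Fin k → Fin d → ℚ) {q : MvPolynomial (Fin k × (Fin d ⊕ Fin n)) K}
    (hq : ∀ᶠ t : ℝ in nhds 0, aeval (point F fun i j => x i j + t * η i j) q = 0) (r : ℕ) :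
    aeval (point F x) ((mkDerivation K (sysField f η))^[r] q) = 0 := by
  suffices h : ∀ᶠ t : ℝ in nhds 0, aeval (point F fun i j => x i j + t * η i j)
      ((mkDerivation K (sysField f η))^[r] q) = 0 by simpa using h.self_of_nhds
  have hB : ∀ᶠ t : ℝ in nhds 0, ∀ i, (fun j => x i j + t * η i j) ∈ B := by
    refine Filter.eventually_all.2 fun i => ?_
    have : ContinuousAt (fun t : ℝ => fun j => x i j + t * (η i j : ℝ)) 0 := by fun_prop
    exact this.preimage_mem_nhds (hF.isOpen.mem_nhds (by simpa using hx i))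
  induction r with
  | zero => exact hq
  | succ r ih =>
    filter_upwards [ih.eventually_nhds, hB] with t ht htB
    rw [Function.iterate_succ_apply']
    have h1 := hasDerivAt_aeval_of_eq_mul (hF.hasDerivAt_point x η t htB)
      ((mkDerivation K (sysField f η))^[r] q)
    have h2 := h1.unique ((hasDerivAt_const t (0 : ℂ)).congr_of_eventuallyEq ht)
    exact (mul_eq_zero.1 h2).resolve_left
      (inv_ne_zero (separant_ne_zero fun i => hF.isSimpleSol _ (htB i)))

end IsBranch

end EtaleSystems

section Density

open MvPolynomial

/-- The tuple `x` satisfies the coordinate equalities prescribed by `E`. -/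
def IsCompat {k d : ℕ} {L : Type*} (E : Fin k → Fin k → Fin d → Prop) (x : Fin k → Fin d → L) :
    Prop :=
  ∀ i i' j, E i i' j → x i j = x i' j

theorem exists_rat_approx (m : ℕ) (v : ℝ) : ∃ r : ℚ, v < r ∧ r < v + 1 / ((m : ℝ) + 1) :=
  exists_rat_btwn (by linarith [show (0 : ℝ) < 1 / ((m : ℝ) + 1) by positivity])

namespace IsBranch

variable {k d n : ℕ} {K : Type*} [Field K] [CharZero K] [Algebra K ℂ]
  {f : Fin n → MvPolynomial (Option (Fin d)) K} {B : Set (Fin d → ℝ)}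
  {F : (Fin d → ℝ) → Fin n → ℂ} {E : Fin k → Fin k → Fin d → Prop}

omit [CharZero K] in
theorem continuousAt_aeval_point (hF : IsBranch f B F) {x : Fin k → Fin d → ℝ} (hx : ∀ i, x i ∈ B)
    (q : MvPolynomial (Fin k × (Fin d ⊕ Fin n)) K) :
    ContinuousAt (fun x => aeval (point F x) q) x := by
  have h1 : ∀ v, ContinuousAt (fun x : Fin k → Fin d → ℝ => point F x v) x := by
    rintro ⟨i, j | l⟩
    · change ContinuousAt (fun x : Fin k → Fin d → ℝ => ((x i j : ℝ) : ℂ)) x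
      exact (Complex.continuous_ofReal.comp ((continuous_apply j).comp (continuous_apply i))).continuousAt
    · change ContinuousAt (fun x : Fin k → Fin d → ℝ => F (x i) l) x
      have h2 : ContinuousAt (fun z => F z l) (x i) :=
        (differentiableAt_pi.1 (hF.differentiableAt _ (hx i)) l).continuousAt
      exact ContinuousAt.comp (g := fun z => F z l) (f := fun x : Fin k → Fin d → ℝ => x i) h2
        (continuousAt_apply i x)
  induction q using MvPolynomial.induction_on with
  | C a => simpa using continuousAt_const
  | add p q hp hq =>
    simp only [map_add]
    exact hp.add hq
  | mul_X p i hp =>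
    simp only [map_mul, aeval_X]
    exact hp.mul (h1 i)

theorem aeval_eq_zero_of_isCompat (hF : IsBranch f B F) (hB : Convex ℝ B) {c : Fin k → Fin d → ℝ}
    (hc : ∀ i, c i ∈ B) (hcE : IsCompat E c) {q : MvPolynomial (Fin k × (Fin d ⊕ Fin n)) K}
    (hq : ∀ η : Fin k → Fin d → ℚ, IsCompat E η → ∀ r,
      aeval (point F c) ((mkDerivation K (sysField f η))^[r] q) = 0)
    {x : Fin k → Fin d → ℝ} (hx : ∀ i, x i ∈ B) (hxE : IsCompat E x) :
    aeval (point F x) q = 0 := by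
  choose ρ hρ₁ hρ₂ using exists_rat_approx
  let η : ℕ → Fin k → Fin d → ℚ := fun m i j => ρ m (x i j - c i j)
  have hηE : ∀ m, IsCompat E (η m) := fun m i i' j h => by
    simp only [η, hxE i i' j h, hcE i i' j h]
  let X : ℕ → Fin k → Fin d → ℝ := fun m i j => c i j + η m i j
  have hX : Filter.Tendsto X Filter.atTop (nhds x) := by
    refine tendsto_pi_nhds.2 fun i => tendsto_pi_nhds.2 fun j => ?_
    have h1 : Filter.Tendsto (fun m : ℕ => x i j + 1 / ((m : ℝ) + 1)) Filter.atTop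
        (nhds (x i j + 0)) := tendsto_one_div_add_atTop_nhds_zero_nat.const_add _
    rw [add_zero] at h1
    refine tendsto_of_tendsto_of_tendsto_of_le_of_le tendsto_const_nhds h1 (fun m => ?_)
      fun m => ?_
    · have := hρ₁ m (x i j - c i j)
      simp only [X, η]
      linarith
    · have := hρ₂ m (x i j - c i j)
      simp only [X, η]
      linarith
  have hXB : ∀ᶠ m in Filter.atTop, ∀ i, X m i ∈ B := Filter.eventually_all.2 fun i =>
    ((tendsto_pi_nhds.1 hX) i).eventually (hF.isOpen.mem_nhds (hx i))
  have hX0 : ∀ᶠ m in Filter.atTop, aeval (point F (X m)) q = 0 := by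
    filter_upwards [hXB] with m hm
    refine hF.aeval_eq_zero_of_segment c (η m) (fun t ht i => ?_) (hq _ (hηE m))
    exact hB.add_smul_mem (hc i) (hm i) ht
  have h1 : Filter.Tendsto (fun m => aeval (point F (X m)) q) Filter.atTop _ :=
    (hF.continuousAt_aeval_point hx q).tendsto.comp hX
  exact tendsto_nhds_unique h1 (tendsto_const_nhds.congr' (hX0.mono fun _ h => h.symm))

theorem iterate_eq_zero_of_isCompat (hF : IsBranch f B F)
    {q : MvPolynomial (Fin k × (Fin d ⊕ Fin n)) K}
    (hq : ∀ x : Fin k → Fin d → ℝ, (∀ i, x i ∈ B) → IsCompat E x → aeval (point F x) q = 0)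
    {η : Fin k → Fin d → ℚ} (hη : IsCompat E η) {x : Fin k → Fin d → ℝ} (hx : ∀ i, x i ∈ B)
    (hxE : IsCompat E x) (r : ℕ) :
    aeval (point F x) ((mkDerivation K (sysField f η))^[r] q) = 0 := by
  refine hF.iterate_eq_zero x hx η ?_ r
  have hB : ∀ᶠ t : ℝ in nhds 0, ∀ i, (fun j => x i j + t * η i j) ∈ B := by
    refine Filter.eventually_all.2 fun i => ?_
    have : ContinuousAt (fun t : ℝ => fun j => x i j + t * (η i j : ℝ)) 0 := by fun_prop
    exact this.preimage_mem_nhds (hF.isOpen.mem_nhds (by simpa using hx i))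
  filter_upwards [hB] with t ht
  exact hq _ ht fun i i' j h => by simp only [hxE i i' j h, hη i i' j h]

end IsBranch

end Density

section Branches

open MvPolynomial
open scoped Topology

section Implicit

variable {d n : ℕ} {K : Type*} [Field K] [Algebra K ℂ]

theorem contDiff_evalParam (f : MvPolynomial (Option (Fin d)) K) :
    ContDiff ℝ 1 fun z : (Fin d → ℝ) × ℂ => evalParam f (fun j => (z.1 j : ℂ)) z.2 := by
  have h1 : ∀ o : Option (Fin d), ContDiff ℝ 1 fun z : (Fin d → ℝ) × ℂ =>
      (o.elim z.2 fun j => (z.1 j : ℂ) : ℂ) := by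
    rintro (_ | j)
    · exact contDiff_snd
    · exact Complex.ofRealCLM.contDiff.comp
        ((contDiff_apply ℝ ℝ j).comp contDiff_fst)
  unfold evalParam
  induction f using MvPolynomial.induction_on with
  | C a =>
    simp only [aeval_C]
    exact contDiff_const
  | add p q hp hq =>
    simp only [map_add]
    exact hp.add hq
  | mul_X p i hp =>
    simp only [map_mul, aeval_X]
    exact hp.mul (h1 i)

theorem hasStrictFDerivAt_evalParam (f : MvPolynomial (Option (Fin d)) K) (x : Fin d → ℝ) (w : ℂ)
    (h1 : evalParam (pderiv none f) (fun j => (x j : ℂ)) w ≠ 0) :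
    ∃ f' : ((Fin d → ℝ) × ℂ) →L[ℝ] ℂ,
      HasStrictFDerivAt (fun z : (Fin d → ℝ) × ℂ => evalParam f (fun j => (z.1 j : ℂ)) z.2) f'
        (x, w) ∧ (f' ∘L .inr ℝ (Fin d → ℝ) ℂ).IsInvertible := by
  have hs := (contDiff_evalParam f).contDiffAt (x := (x, w)).hasStrictFDerivAt one_ne_zero
  refine ⟨_, hs, ?_⟩
  set f' := fderiv ℝ (fun z : (Fin d → ℝ) × ℂ => evalParam f (fun j => (z.1 j : ℂ)) z.2) (x, w)
  have h2 : ∀ v : ℂ, (f' ∘L .inr ℝ (Fin d → ℝ) ℂ) v =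
      evalParam (pderiv none f) (fun j => (x j : ℂ)) w * v := by
    intro v
    have hcurve : HasDerivAt (fun t : ℝ => (x, w + t * v)) ((0 : Fin d → ℝ), v) 0 := by
      refine (hasDerivAt_const _ _).prodMk ?_
      simpa using ((Complex.ofRealCLM.hasDerivAt (x := (0 : ℝ))).mul_const v).const_add w
    have hA : HasDerivAt (fun t : ℝ => evalParam f (fun j => (x j : ℂ)) (w + t * v))
        (f' (0, v)) 0 := by
      have h3 : HasFDerivAt (fun z : (Fin d → ℝ) × ℂ => evalParam f (fun j => (z.1 j : ℂ)) z.2) f'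
        (x, w + ((0 : ℝ) : ℂ) * v) := by simpa using hs.hasFDerivAt
      exact h3.comp_hasDerivAt (0 : ℝ) hcurve
    have hB := hasDerivAt_aeval (γ := fun (t : ℝ) (o : Option (Fin d)) =>
        (o.elim (w + t * v) fun j => (x j : ℂ) : ℂ)) (γ' := fun o => o.elim v 0) (t := 0) (by
      rintro (_ | j)
      · simpa using ((Complex.ofRealCLM.hasDerivAt (x := (0 : ℝ))).mul_const v).const_add w
      · exact hasDerivAt_const _ _) f
    have h4 := hA.unique hB
    rw [Fintype.sum_option] at h4
    simpa [evalParam] using h4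
  refine ⟨(LinearEquiv.ofInjectiveEndo ((f' ∘L .inr ℝ (Fin d → ℝ) ℂ : ℂ →L[ℝ] ℂ) : ℂ →ₗ[ℝ] ℂ)
    ?_).toContinuousLinearEquiv, ?_⟩
  · rw [← LinearMap.ker_eq_bot, LinearMap.ker_eq_bot']
    intro v hv
    have := (h2 v).symm.trans hv
    exact (mul_eq_zero.1 this).resolve_left h1
  · ext v
    all_goals rfl

/-- Simple roots persist, and are isolated, locally uniformly in the parameters. -/
theorem exists_isolating_nhds {f : MvPolynomial (Option (Fin d)) K} {x₀ : Fin d → ℝ} {w₀ : ℂ}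
    (h0 : evalParam f (fun j => (x₀ j : ℂ)) w₀ = 0)
    (h1 : evalParam (pderiv none f) (fun j => (x₀ j : ℂ)) w₀ ≠ 0) :
    ∃ V₀ ∈ 𝓝 w₀, ∀ V ∈ 𝓝 w₀, V ⊆ V₀ → ∀ᶠ x in 𝓝 x₀, ∃ w ∈ V,
      (evalParam f (fun j => (x j : ℂ)) w = 0 ∧
        evalParam (pderiv none f) (fun j => (x j : ℂ)) w ≠ 0) ∧
      ∀ w' ∈ V, evalParam f (fun j => (x j : ℂ)) w' = 0 → w' = w := by
  obtain ⟨f', hs, hinv⟩ := hasStrictFDerivAt_evalParam f x₀ w₀ h1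
  have hA := hs.eventually_apply_eq_iff_implicitFunctionOfProdDomain hinv
  have hT := hs.tendsto_implicitFunctionOfProdDomain hinv
  set ψ := hs.implicitFunctionOfProdDomain hinv
  have hB : ∀ᶠ z : (Fin d → ℝ) × ℂ in 𝓝 (x₀, w₀),
      evalParam (pderiv none f) (fun j => (z.1 j : ℂ)) z.2 ≠ 0 :=
    (contDiff_evalParam (pderiv none f)).continuous.continuousAt.eventually_ne h1
  obtain ⟨U, hU, V₀, hV₀, hUV⟩ := mem_nhds_prod_iff.1 (hA.and hB)
  refine ⟨V₀, hV₀, fun V hV hVV => ?_⟩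
  filter_upwards [hU, hT.eventually hV] with x hx hψ
  have h2 := hUV (Set.mk_mem_prod hx (hVV hψ))
  refine ⟨ψ x, hψ, ⟨?_, h2.2⟩, fun w' hw' h' => ?_⟩
  · exact (h2.1.2 rfl).trans h0
  · have h3 := hUV (Set.mk_mem_prod hx (hVV hw'))
    exact (h3.1.1 (h'.trans h0.symm)).symm

/-- The open box with the given endpoints. -/
def openBox (lo hi : Fin d → ℝ) : Set (Fin d → ℝ) :=
  Set.univ.pi fun j => Set.Ioo (lo j) (hi j)

theorem isOpen_openBox (lo hi : Fin d → ℝ) : IsOpen (openBox lo hi) :=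
  isOpen_set_pi Set.finite_univ fun _ _ => isOpen_Ioo

theorem convex_openBox (lo hi : Fin d → ℝ) : Convex ℝ (openBox lo hi) :=
  convex_pi fun _ _ => convex_Ioo _ _

theorem exists_openBox_subset {x : Fin d → ℝ} {U : Set (Fin d → ℝ)} (hU : U ∈ 𝓝 x) :
    ∃ lo hi : Fin d → ℚ, x ∈ openBox (fun j => lo j) (fun j => hi j) ∧
      openBox (fun j => lo j) (fun j => hi j) ⊆ U ∧
      ∀ j j', x j ≠ x j' → Disjoint (Set.Ioo (lo j : ℝ) (hi j)) (Set.Ioo (lo j' : ℝ) (hi j')) := by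
  obtain ⟨ε₀, hε₀, hb⟩ := Metric.mem_nhds_iff.1 hU
  have h1 : ∀ᶠ ε : ℝ in 𝓝[>] 0, 0 < ε ∧ ε < ε₀ ∧ ∀ j j', x j ≠ x j' → 2 * ε < |x j - x j'| := by
    refine (eventually_mem_nhdsWithin).and (((eventually_lt_nhds hε₀).filter_mono nhdsWithin_le_nhds).and ?_)
    refine Filter.eventually_all.2 fun j => Filter.eventually_all.2 fun j' => ?_
    by_cases h : x j = x j'
    · exact Filter.Eventually.of_forall fun ε hε => absurd h hε
    · have h2 : (0 : ℝ) < |x j - x j'| / 2 := half_pos (abs_pos.2 (sub_ne_zero.2 h))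
      filter_upwards [(eventually_lt_nhds h2).filter_mono nhdsWithin_le_nhds] with ε hε _
      linarith
  obtain ⟨ε, hε, hεε₀, hsep⟩ := h1.exists
  choose lo hlo₁ hlo₂ using fun j => exists_rat_btwn (show x j - ε < x j by linarith)
  choose hi hhi₁ hhi₂ using fun j => exists_rat_btwn (show x j < x j + ε by linarith)
  refine ⟨lo, hi, fun j _ => ⟨hlo₂ j, hhi₁ j⟩, fun y hy => hb ?_, fun j j' hjj => ?_⟩
  · rw [Metric.mem_ball]
    refine lt_of_le_of_lt ((dist_pi_le_iff hε.le).2 fun j => ?_) hεε₀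
    have h2 := hy j trivial
    rw [Real.dist_eq, abs_le]
    constructor <;> linarith [h2.1, h2.2, hlo₁ j, hhi₂ j]
  · rw [Set.disjoint_left]
    rintro t ht ht'
    have h2 := hsep j j' hjj
    have h3 : |x j - x j'| ≤ 2 * ε := by
      rw [abs_le]
      constructor <;> linarith [ht.1, ht.2, ht'.1, ht'.2, hlo₁ j, hhi₂ j, hlo₁ j', hhi₂ j']
    linarith

/-- Over every point of `B`, each equation of the system `f` has exactly one root in the given
open set, and this root is simple. -/
structure IsIsolating (f : Fin n → MvPolynomial (Option (Fin d)) K) (B : Set (Fin d → ℝ))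
    (V : Fin n → Set ℂ) : Prop where
  isOpen : IsOpen B
  isOpen_root : ∀ l, IsOpen (V l)
  exists_root : ∀ x ∈ B, ∀ l, ∃ w ∈ V l,
    (evalParam (f l) (fun j => (x j : ℂ)) w = 0 ∧
      evalParam (pderiv none (f l)) (fun j => (x j : ℂ)) w ≠ 0) ∧
    ∀ w' ∈ V l, evalParam (f l) (fun j => (x j : ℂ)) w' = 0 → w' = w

/-- A choice of roots of the system `f` in the given sets. -/
noncomputable def rootFun (f : Fin n → MvPolynomial (Option (Fin d)) K) (V : Fin n → Set ℂ)
    (x : Fin d → ℝ) (l : Fin n) : ℂ :=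
  Classical.epsilon fun w => w ∈ V l ∧ evalParam (f l) (fun j => (x j : ℂ)) w = 0

namespace IsIsolating

variable {f : Fin n → MvPolynomial (Option (Fin d)) K} {B : Set (Fin d → ℝ)} {V : Fin n → Set ℂ}

theorem mono {B' : Set (Fin d → ℝ)} (h : IsIsolating f B V) (hB : B' ⊆ B) (hB' : IsOpen B') :
    IsIsolating f B' V :=
  ⟨hB', h.isOpen_root, fun x hx => h.exists_root x (hB hx)⟩

theorem rootFun_spec (h : IsIsolating f B V) {x : Fin d → ℝ} (hx : x ∈ B) (l : Fin n) :
    rootFun f V x l ∈ V l ∧ evalParam (f l) (fun j => (x j : ℂ)) (rootFun f V x l) = 0 := by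
  obtain ⟨w, hw, hw0, -⟩ := h.exists_root x hx l
  exact Classical.epsilon_spec (p := fun w => w ∈ V l ∧
    evalParam (f l) (fun j => (x j : ℂ)) w = 0) ⟨w, hw, hw0.1⟩

theorem eq_rootFun (h : IsIsolating f B V) {x : Fin d → ℝ} (hx : x ∈ B) {l : Fin n} {w : ℂ}
    (hw : w ∈ V l) (h0 : evalParam (f l) (fun j => (x j : ℂ)) w = 0) : w = rootFun f V x l := by
  obtain ⟨w', hw', hw0, hu⟩ := h.exists_root x hx l
  have h1 := h.rootFun_spec hx l
  rw [hu w hw h0, hu _ h1.1 h1.2]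

theorem isSimpleSol (h : IsIsolating f B V) {x : Fin d → ℝ} (hx : x ∈ B) :
    IsSimpleSol f (fun j => (x j : ℂ)) (rootFun f V x) := by
  intro l
  obtain ⟨w, hw, hw0, hu⟩ := h.exists_root x hx l
  rwa [← h.eq_rootFun hx hw hw0.1]

theorem isBranch (h : IsIsolating f B V) : IsBranch f B (rootFun f V) := by
  refine ⟨h.isOpen, fun x hx => differentiableAt_pi.2 fun l => ?_, fun x hx => h.isSimpleSol hx⟩
  have h0 := h.isSimpleSol hx l
  obtain ⟨f', hs, hinv⟩ := hasStrictFDerivAt_evalParam (f l) x (rootFun f V x l) h0.2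
  have hψ := (hs.hasStrictFDerivAt_implicitFunctionOfProdDomain hinv).hasFDerivAt.differentiableAt
  refine hψ.congr_of_eventuallyEq ?_
  filter_upwards [(hs.tendsto_implicitFunctionOfProdDomain hinv).eventually
    ((h.isOpen_root l).mem_nhds (h.rootFun_spec hx l).1),
    hs.eventually_apply_implicitFunctionOfProdDomain hinv, h.isOpen.mem_nhds hx] with y hy hy0 hyB
  exact (h.eq_rootFun hyB hy (hy0.trans h0.1)).symm

end IsIsolating

theorem exists_isIsolating {f : Fin n → MvPolynomial (Option (Fin d)) K} {x : Fin d → ℝ}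
    {a : Fin n → ℂ} (h : IsSimpleSol f (fun j => (x j : ℂ)) a) :
    ∃ (lo hi : Fin d → ℚ) (V : Fin n → Set ℂ), (∀ l, V l ∈ TopologicalSpace.countableBasis ℂ) ∧
      x ∈ openBox (fun j => lo j) (fun j => hi j) ∧
      (∀ j j', x j ≠ x j' →
        Disjoint (Set.Ioo (lo j : ℝ) (hi j)) (Set.Ioo (lo j' : ℝ) (hi j'))) ∧
      IsIsolating f (openBox (fun j => lo j) (fun j => hi j)) V ∧ a = rootFun f V x := by
  have hb := TopologicalSpace.isBasis_countableBasis ℂ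
  choose V₀ hV₀ hV using fun l => exists_isolating_nhds (h l).1 (h l).2
  choose V hVb haV hVV using fun l => hb.mem_nhds_iff.1 (hV₀ l)
  have h1 := Filter.eventually_all.2 fun l =>
    hV l (V l) ((hb.isOpen (hVb l)).mem_nhds (haV l)) (hVV l)
  obtain ⟨lo, hi, hx, hsub, hdisj⟩ := exists_openBox_subset h1
  have hI : IsIsolating f (openBox (fun j => (lo j : ℝ)) (fun j => (hi j : ℝ))) V :=
    ⟨isOpen_openBox _ _, fun l => hb.isOpen (hVb l), fun y hy => hsub hy⟩
  have ha : a = rootFun f V x := by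
    funext l
    exact hI.eq_rootFun hx (haV l) (h l).1
  exact ⟨lo, hi, V, hVb, hx, hdisj, hI, ha⟩

theorem evalParam_algHom {K L M : Type*} [Field K] [Field L] [Field M] [Algebra K L] [Algebra K M]
    (Φ : L →ₐ[K] M) (f : MvPolynomial (Option (Fin d)) K) (s : Fin d → L) (w : L) :
    evalParam f (fun j => Φ (s j)) (Φ w) = Φ (evalParam f s w) := by
  rw [evalParam, evalParam, ← AlgHom.comp_apply, comp_aeval]
  congr 2
  funext o
  cases o <;> rfl

theorem isSimpleSol_algHom {K L M : Type*} [Field K] [Field L] [Field M] [Algebra K L]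
    [Algebra K M] (Φ : L →ₐ[K] M) {f : Fin n → MvPolynomial (Option (Fin d)) K} {s : Fin d → L}
    {a : Fin n → L} :
    IsSimpleSol f (fun j => Φ (s j)) (fun l => Φ (a l)) ↔ IsSimpleSol f s a := by
  simp only [IsSimpleSol, evalParam_algHom, map_eq_zero, ne_eq]

theorem isFullySupported_algHom {K L M : Type*} [Field K] [Field L] [Field M] [Algebra K L]
    [Algebra K M] (Φ : L →ₐ[K] M) {f : Fin n → MvPolynomial (Option (Fin d)) K} {s : Fin d → L}
    {a : Fin n → L} :
    IsFullySupported f (fun j => Φ (s j)) (fun l => Φ (a l)) ↔ IsFullySupported f s a := by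
  simp only [IsFullySupported, evalParam_algHom, map_eq_zero, ne_eq]

end Implicit

section RealBranch

variable {d n : ℕ} {K : Type*} [Field K] [Algebra K ℝ]

/-- A fully supported real simple solution extends to a real branch on a box. -/
theorem exists_real_isBranch {f : Fin n → MvPolynomial (Option (Fin d)) K} {c : Fin d → ℝ}
    {a : Fin n → ℝ} (h : IsSimpleSol f c a) (hs : IsFullySupported f c a) :
    ∃ (lo hi : Fin d → ℚ) (F : (Fin d → ℝ) → Fin n → ℝ),
      c ∈ openBox (fun j => lo j) (fun j => hi j) ∧ F c = a ∧
      IsBranch f (openBox (fun j => lo j) (fun j => hi j)) (fun x l => (F x l : ℂ)) ∧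
      ∀ x ∈ openBox (fun j => (lo j : ℝ)) (fun j => (hi j : ℝ)),
        IsSimpleSol f x (F x) ∧ IsFullySupported f x (F x) := by
  let ι : ℝ →ₐ[K] ℂ := Complex.ofRealAm.restrictScalars K
  let conj : ℂ →ₐ[K] ℂ := (Complex.conjAe : ℂ →ₐ[ℝ] ℂ).restrictScalars K
  obtain ⟨lo, hi, V, -, hc, -, hI, haF⟩ := exists_isIsolating (f := f) (x := c)
    (a := fun l => (a l : ℂ)) ((isSimpleSol_algHom ι).2 h)
  set G := rootFun f V
  have hB := hI.isBranch
  have hG : ContinuousAt G c := (hB.differentiableAt c hc).continuousAt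
  have h1 : ∀ᶠ x in 𝓝 c, ∀ l, (starRingEnd ℂ) (G x l) ∈ V l := by
    refine Filter.eventually_all.2 fun l => ?_
    have h2 : ContinuousAt (fun x => (starRingEnd ℂ) (G x l)) c :=
      Complex.continuous_conj.continuousAt.comp ((continuous_apply l).continuousAt.comp hG)
    refine h2.preimage_mem_nhds ((hI.isOpen_root l).mem_nhds ?_)
    have h3 := (hI.rootFun_spec hc l).1
    have h4 : G c l = a l := (congrFun haF l).symm
    change (starRingEnd ℂ) (G c l) ∈ _
    rw [h4, Complex.conj_ofReal, ← h4]
    exact h3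
  have h2 : ∀ᶠ x in 𝓝 c, IsFullySupported f (fun j => (x j : ℂ)) (G x) := by
    refine Filter.eventually_all.2 fun j => ?_
    obtain ⟨l, hl⟩ := (isFullySupported_algHom ι).2 hs j
    have h3 : ContinuousAt (fun x => evalParam (pderiv (some j) (f l)) (fun j => (x j : ℂ))
        (G x l)) c :=
      (contDiff_evalParam (pderiv (some j) (f l))).continuous.continuousAt.comp
        (f := fun x => (x, G x l)) (continuousAt_id.prodMk
          ((continuous_apply l).continuousAt.comp hG))
    have h4 : G c l = a l := (congrFun haF l).symm
    have h5 : evalParam (pderiv (some j) (f l)) (fun j => (c j : ℂ)) (G c l) ≠ 0 := by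
      rw [h4]
      exact hl
    exact (h3.eventually_ne h5).mono fun x hx => ⟨l, hx⟩
  obtain ⟨lo', hi', hc', hsub, -⟩ := exists_openBox_subset
    (Filter.inter_mem (h1.and h2) (hI.isOpen.mem_nhds hc))
  have hreal : ∀ x ∈ openBox (fun j => (lo' j : ℝ)) (fun j => (hi' j : ℝ)), ∀ l,
      (((G x l).re : ℝ) : ℂ) = G x l := by
    intro x hx l
    have h3 := hsub hx
    refine Complex.conj_eq_iff_re.1 (hI.eq_rootFun h3.2 (h3.1.1 l) ?_)
    have h4 := evalParam_algHom conj (f l) (fun j => (x j : ℂ)) (G x l)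
    rw [(hI.rootFun_spec h3.2 l).2, map_zero] at h4
    rw [← h4]
    congr 1
    funext j
    exact (Complex.conj_ofReal _).symm
  have hB' := (hI.mono (fun x hx => (hsub hx).2) (isOpen_openBox _ _)).isBranch
  refine ⟨lo', hi', fun x l => (G x l).re, hc', ?_, ⟨hB'.isOpen, fun x hx => ?_, fun x hx => ?_⟩,
    fun x hx => ⟨?_, ?_⟩⟩
  · funext l
    change (G c l).re = a l
    rw [show G c l = a l from (congrFun haF l).symm, Complex.ofReal_re]
  · refine (hB'.differentiableAt x hx).congr_of_eventuallyEq ?_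
    filter_upwards [(isOpen_openBox _ _).mem_nhds hx] with y hy
    funext l
    exact hreal y hy l
  · rw [funext (hreal x hx)]
    exact hB'.isSimpleSol x hx
  · rw [← isSimpleSol_algHom ι]
    have h3 : (fun l => ι (G x l).re) = G x := funext (hreal x hx)
    rw [h3]
    exact hB'.isSimpleSol x hx
  · rw [← isFullySupported_algHom ι]
    have h3 : (fun l => ι (G x l).re) = G x := funext (hreal x hx)
    rw [h3]
    exact (hsub hx).1.2

end RealBranch

end Branches

section Transcendence

open MvPolynomial Cardinal

theorem IsTranscendenceBasis.mk_real_eq_continuum {K ι : Type} [Field K] [Algebra K ℝ]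
    (hK : #K ≤ ℵ₀) {x : ι → ℝ} (hx : IsTranscendenceBasis K x) : #ι = 𝔠 := by
  have h1 : IsTranscendenceBasis K (algebraMap ℝ ℂ ∘ x) := hx.algebraMap_comp
  have h2 := IsAlgClosed.cardinal_eq_cardinal_transcendence_basis_of_aleph0_lt' _ h1 hK
    (by rw [mk_complex]; exact aleph0_lt_continuum)
  rw [← h2, mk_complex]

/-- A field of cardinality at most the continuum embeds into `ℂ` in such a way that a given
transcendence basis has real values. -/
theorem IsTranscendenceBasis.exists_algHom_complex {K R : Type} [Field K] [Field R] [Algebra K ℝ]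
    [Algebra K R] (hK : #K ≤ ℵ₀) (hR : #R ≤ 𝔠) {T : Set R}
    (hT : IsTranscendenceBasis K ((↑) : T → R)) :
    ∃ (Φ : R →ₐ[K] ℂ) (ρ : T → ℝ), ∀ t : T, Φ (t : R) = ρ t := by
  obtain ⟨S, hS⟩ := exists_isTranscendenceBasis K ℝ
  have h1 : #T ≤ #S := by
    rw [hS.mk_real_eq_continuum hK]
    exact (mk_set_le T).trans hR
  obtain ⟨e⟩ := h1
  let ρ : T → ℝ := fun t => e t
  have hρ : AlgebraicIndependent K ρ := hS.1.comp e e.injective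
  have hρC : AlgebraicIndependent K (fun t => (ρ t : ℂ)) :=
    hρ.map' (f := Complex.ofRealAm.restrictScalars K) Complex.ofReal_injective
  let : Algebra (MvPolynomial T K) R := (aeval ((↑) : T → R)).toAlgebra
  let : Algebra (MvPolynomial T K) ℂ := (aeval (fun t => (ρ t : ℂ))).toAlgebra
  have : FaithfulSMul (MvPolynomial T K) R := (faithfulSMul_iff_algebraMap_injective _ _).2 hT.1
  have : FaithfulSMul (MvPolynomial T K) ℂ := (faithfulSMul_iff_algebraMap_injective _ _).2 hρC
  have : Module.IsTorsionFree (MvPolynomial T K) R := inferInstance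
  have : IsScalarTower K (MvPolynomial T K) R := .of_algebraMap_eq fun r => by
    rw [RingHom.algebraMap_toAlgebra]; simp
  have : IsScalarTower K (MvPolynomial T K) ℂ := .of_algebraMap_eq fun r => by
    rw [RingHom.algebraMap_toAlgebra]; simp
  have : Algebra.IsAlgebraic (MvPolynomial T K) R := by
    have := hT.isAlgebraic
    refine .of_ringHom_of_comp_eq hT.1.aevalEquiv (RingHom.id R) hT.1.aevalEquiv.surjective
      Function.injective_id (RingHom.ext fun p => ?_)
    exact hT.1.algebraMap_aevalEquiv p
  let Φ : R →ₐ[MvPolynomial T K] ℂ := IsAlgClosed.lift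
  refine ⟨Φ.restrictScalars K, ρ, fun t : T => ?_⟩
  have h2 := Φ.commutes (X t)
  rw [RingHom.algebraMap_toAlgebra, RingHom.algebraMap_toAlgebra] at h2
  simpa using h2

end Transcendence

section Templates

open MvPolynomial Cardinal

/-- Every finite tuple of `R` specializes to a real tuple satisfying the same equations over `K`
and a prescribed inequation. -/
def SpecializesToReal (K R : Type) [Field K] [Field R] [Algebra K ℝ] [Algebra K R] : Prop :=
  ∀ (σ : Type) [Finite σ] (v : σ → R) (g : MvPolynomial σ K), aeval v g ≠ 0 →
    ∃ c : σ → ℝ, (∀ h : MvPolynomial σ K, aeval v h = 0 → aeval c h = 0) ∧ aeval c g ≠ 0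

/-- A parametrized family of real tuples, injective on independent parameters, such that every
`k` parameters satisfying the equalities `E` give a zero of `q`. -/
structure IsRealTemplate {k d n : ℕ} {K : Type} [Field K] [Algebra K ℝ]
    (q : MvPolynomial (Fin k × Fin n) K) (E : Fin k → Fin k → Fin d → Prop) (lo hi : Fin d → ℝ)
    (F : (Fin d → ℝ) → Fin n → ℝ) : Prop where
  nonempty : (openBox lo hi).Nonempty
  injective : ∀ (Y : Type) (y : Fin d → Y → ℝ),
    AlgebraicIndependent K (fun v : Fin d × Y => y v.1 v.2) →
    (∀ j t, y j t ∈ Set.Ioo (lo j) (hi j)) → Function.Injective fun u : Fin d → Y =>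
      F fun j => y j (u j)
  eq_zero : ∀ x : Fin k → Fin d → ℝ, (∀ i, x i ∈ openBox lo hi) → IsCompat E x →
    aeval (fun v => F (x v.1) v.2) q = 0

theorem injective_of_isFullySupported {d n : ℕ} {K : Type} [Field K] [Algebra K ℝ]
    {f : Fin n → MvPolynomial (Option (Fin d)) K} {B : Set (Fin d → ℝ)}
    {F : (Fin d → ℝ) → Fin n → ℝ}
    (hF : ∀ x ∈ B, IsSimpleSol f x (F x) ∧ IsFullySupported f x (F x)) {Y : Type}
    {y : Fin d → Y → ℝ} (hy : AlgebraicIndependent K (fun v : Fin d × Y => y v.1 v.2))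
    (hB : ∀ u : Fin d → Y, (fun j => y j (u j)) ∈ B) :
    Function.Injective fun u : Fin d → Y => F fun j => y j (u j) := by
  classical
  intro u u' (h : F _ = F _)
  by_contra hne
  obtain ⟨j₀, hj₀⟩ := Function.ne_iff.1 hne
  obtain ⟨D, hD⟩ := hy.exists_derivation fun v => if v = (j₀, u j₀) then (1 : ℝ) else 0
  have hD' : ∀ j t, D (y j t) = if (j, t) = (j₀, u j₀) then (1 : ℝ) else 0 := fun j t => hD (j, t)
  obtain ⟨l, hl⟩ := (hF _ (hB u)).2 j₀
  have h1 := (hF _ (hB u)).1 l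
  have h2 := (hF _ (hB u')).1 l
  rw [← h] at h2
  have h3 := D.eq_implicitDer h1.1 h1.2
  rw [D.eq_implicitDer h2.1 h2.2] at h3
  have h4 : ∀ j, (j, u' j) ≠ (j₀, u j₀) := by
    rintro j hj
    obtain ⟨rfl, h5⟩ := Prod.ext_iff.1 hj
    exact hj₀ h5.symm
  have h5 : ∀ j, (j, u j) = (j₀, u j₀) ↔ j = j₀ :=
    fun j => ⟨fun hj => (Prod.ext_iff.1 hj).1, fun hj => by rw [hj]⟩
  simp only [hD', h4, if_false, h5, implicitDer, mul_zero, Finset.sum_const_zero, neg_zero,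
    zero_div, mul_ite, mul_one, Finset.sum_ite_eq', Finset.mem_univ, if_true] at h3
  have h6 := (div_eq_zero_iff.1 h3.symm).resolve_right h1.2
  exact hl (neg_eq_zero.1 h6)

theorem sysPoint_algHom {k d n : ℕ} {K L M : Type*} [Field K] [Field L] [Field M] [Algebra K L]
    [Algebra K M] (Φ : L →ₐ[K] M) (x : Fin k → Fin d → L) (y : Fin k → Fin n → L)
    (q : MvPolynomial (Fin k × (Fin d ⊕ Fin n)) K) :
    aeval (sysPoint (fun i j => Φ (x i j)) fun i l => Φ (y i l)) q = Φ (aeval (sysPoint x y) q) := by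
  rw [← AlgHom.comp_apply, comp_aeval]
  congr 2
  funext v
  rcases v with ⟨i, j | l⟩ <;> rfl

theorem aeval_sysPoint_const {k d n : ℕ} {K L : Type*} [Field K] [Field L] [Algebra K L]
    (x : Fin d → L) (y : Fin n → L) (q : MvPolynomial (Fin k × (Fin d ⊕ Fin n)) K) :
    aeval (sysPoint (fun _ => x) fun _ => y) q = aeval (Sum.elim x y) (rename Prod.snd q) := by
  rw [aeval_rename]
  rfl

theorem aeval_sysPoint_inr {k d n : ℕ} {K L : Type*} [Field K] [Field L] [Algebra K L]
    (x : Fin k → Fin d → L) (y : Fin k → Fin n → L) (q : MvPolynomial (Fin k × Fin n) K) :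
    aeval (sysPoint x y) (rename (fun v => (v.1, Sum.inr v.2)) q) =
      aeval (fun v => y v.1 v.2) q := by
  rw [aeval_rename]
  rfl

theorem exists_derivation_of_isCompat {k d : ℕ} {K R : Type} [Field K] [Field R] [CharZero R]
    [Algebra K R] {T : Set R} (hT : AlgebraicIndependent K ((↑) : T → R))
    {s : Fin k → Fin d → R} (hsT : ∀ i j, s i j ∈ T)
    (hs : ∀ i j i' j', s i j = s i' j' → j = j') {η : Fin k → Fin d → ℚ}
    (hη : IsCompat (fun i i' j => s i j = s i' j) η) :
    ∃ D : Derivation K R R, ∀ i j, D (s i j) = η i j := by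
  classical
  obtain ⟨D, hD⟩ := hT.exists_derivation fun t =>
    if h : ∃ v : Fin k × Fin d, s v.1 v.2 = t then (η h.choose.1 h.choose.2 : R) else 0
  refine ⟨D, fun i j => ?_⟩
  have h : ∃ v : Fin k × Fin d, s v.1 v.2 = s i j := ⟨(i, j), rfl⟩
  have h1 := hD ⟨s i j, hsT i j⟩
  rw [dif_pos h] at h1
  rw [h1]
  have h2 := h.choose_spec
  have h3 := hs _ _ _ _ h2
  rw [h3] at h2 ⊢
  rw [hη _ _ _ h2]

section

variable {k d n : ℕ} {K R : Type} [Field K] [CharZero K] [Field R] [CharZero R] [Algebra K ℝ]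
  [Algebra K R]

theorem exists_isRealTemplate (hk : 0 < k) (hR : SpecializesToReal K R) {T : Set R}
    (hT : AlgebraicIndependent K ((↑) : T → R)) (Φ : R →ₐ[K] ℂ)
    {f : Fin n → MvPolynomial (Option (Fin d)) K} {lo hi : Fin d → ℝ} {V : Fin n → Set ℂ}
    (hV : IsIsolating f (openBox lo hi) V)
    (hdisj : ∀ j j', j ≠ j' → Disjoint (Set.Ioo (lo j) (hi j)) (Set.Ioo (lo j') (hi j')))
    {a : Fin k → Fin n → R} {s : Fin k → Fin d → R} {x : Fin k → Fin d → ℝ}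
    (hsT : ∀ i j, s i j ∈ T) (hsol : ∀ i, IsSimpleSol f (s i) (a i))
    (hsupp : ∀ i, IsFullySupported f (s i) (a i)) (hsx : ∀ i j, Φ (s i j) = x i j)
    (hx : ∀ i, x i ∈ openBox lo hi) (hax : ∀ i, (fun l => Φ (a i l)) = rootFun f V (x i))
    {q : MvPolynomial (Fin k × Fin n) K} (hq : aeval (fun v => a v.1 v.2) q = 0) :
    ∃ (lo hi : Fin d → ℝ) (F : (Fin d → ℝ) → Fin n → ℝ),
      IsRealTemplate q (fun i i' j => s i j = s i' j) lo hi F := by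
  set E : Fin k → Fin k → Fin d → Prop := fun i i' j => s i j = s i' j with hE
  set q' : MvPolynomial (Fin k × (Fin d ⊕ Fin n)) K :=
    rename (fun v => (v.1, Sum.inr v.2)) q with hq'
  have hxs : ∀ i j i' j', s i j = s i' j' → x i j = x i' j' := fun i j i' j' h => by
    have h1 := hsx i j
    rw [h, hsx] at h1
    exact_mod_cast h1.symm
  have hjj : ∀ i j i' j', s i j = s i' j' → j = j' := fun i j i' j' h => by
    by_contra hne
    refine Set.disjoint_left.1 (hdisj j j' hne) (hx i j trivial) ?_
    rw [hxs i j i' j' h]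
    exact hx i' j' trivial
  have hBr := hV.isBranch
  have hpoint : ∀ ι : Fin k → Fin k, IsBranch.point (rootFun f V) (fun i => x (ι i)) =
      sysPoint (fun i j => Φ (s (ι i) j)) fun i l => Φ (a (ι i) l) := fun ι => by
    simp only [IsBranch.point, ← hsx, ← hax]
  have h1 : ∀ η : Fin k → Fin d → ℚ, IsCompat E η → ∀ r,
      aeval (IsBranch.point (rootFun f V) x) ((mkDerivation K (sysField f η))^[r] q') = 0 := by
    intro η hη r
    obtain ⟨D, hD⟩ := exists_derivation_of_isCompat hT hsT hjj hη
    rw [show IsBranch.point (rootFun f V) x = _ from hpoint id, sysPoint_algHom, map_eq_zero]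
    exact D.aeval_sysField_iterate_eq_zero hsol hD ((aeval_sysPoint_inr _ _ _).trans hq) r
  have h2 : ∀ x' : Fin k → Fin d → ℝ, (∀ i, x' i ∈ openBox lo hi) → IsCompat E x' →
      aeval (IsBranch.point (rootFun f V) x') q' = 0 := fun x' hx' hxE =>
    hBr.aeval_eq_zero_of_isCompat (convex_openBox _ _) hx (fun i i' j h => hxs i j i' j h) h1 hx' hxE
  let i₀ : Fin k := ⟨0, hk⟩
  have h3 : ∀ η : Fin k → Fin d → ℚ, IsCompat E η → ∀ r,
      aeval (Sum.elim (s i₀) (a i₀))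
        (rename Prod.snd ((mkDerivation K (sysField f η))^[r] q')) = 0 := by
    intro η hη r
    have h4 := hBr.iterate_eq_zero_of_isCompat h2 hη (x := fun _ => x i₀) (fun _ => hx i₀)
      (fun _ _ _ _ => rfl) r
    rw [hpoint fun _ => i₀, sysPoint_algHom Φ (fun _ => s i₀) (fun _ => a i₀),
      map_eq_zero] at h4
    rwa [← aeval_sysPoint_const]
  choose l hl using hsupp i₀
  let var : Fin n → Option (Fin d) → Fin d ⊕ Fin n := fun l o => o.elim (Sum.inr l) Sum.inl
  have hvar : ∀ {L : Type} [Field L] [Algebra K L] (v : Fin d ⊕ Fin n → L) (l : Fin n)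
      (g : MvPolynomial (Option (Fin d)) K), aeval v (rename (var l) g) =
        evalParam g (fun j => v (Sum.inl j)) (v (Sum.inr l)) := by
    intro L _ _ v l g
    rw [aeval_rename, evalParam]
    congr 2
    funext o
    cases o <;> rfl
  obtain ⟨c, hc, hcg⟩ := hR (Fin d ⊕ Fin n) (Sum.elim (s i₀) (a i₀))
    ((∏ l, rename (var l) (pderiv none (f l))) *
      ∏ j, rename (var (l j)) (pderiv (some j) (f (l j)))) (by
    simp only [map_mul, map_prod, hvar]
    exact mul_ne_zero (Finset.prod_ne_zero_iff.2 fun l _ => (hsol i₀ l).2)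
      (Finset.prod_ne_zero_iff.2 fun j _ => hl j))
  simp only [map_mul, map_prod, hvar] at hcg
  have hcsol : IsSimpleSol f (fun j => c (Sum.inl j)) (fun l => c (Sum.inr l)) := fun l => by
    refine ⟨?_, Finset.prod_ne_zero_iff.1 (left_ne_zero_of_mul hcg) l (Finset.mem_univ _)⟩
    rw [← hvar]
    exact hc _ ((hvar _ _ _).trans (hsol i₀ l).1)
  have hcsupp : IsFullySupported f (fun j => c (Sum.inl j)) (fun l => c (Sum.inr l)) := fun j =>
    ⟨l j, Finset.prod_ne_zero_iff.1 (right_ne_zero_of_mul hcg) j (Finset.mem_univ _)⟩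
  obtain ⟨lo', hi', F, hcB, hFc, hFB, hFs⟩ := exists_real_isBranch hcsol hcsupp
  let ι : ℝ →ₐ[K] ℂ := Complex.ofRealAm.restrictScalars K
  refine ⟨fun j => lo' j, fun j => hi' j, F, ⟨_, hcB⟩, fun Y y hy hyB =>
    injective_of_isFullySupported hFs hy fun u j _ => hyB j (u j), fun y hy hyE => ?_⟩
  have h5 := hFB.aeval_eq_zero_of_isCompat (convex_openBox _ _) (E := E) (q := q')
    (c := fun _ j => c (Sum.inl j)) (fun _ => hcB) (fun _ _ _ _ => rfl) (fun η hη r => ?_) hy hyE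
  · have h6 := sysPoint_algHom ι y (fun i => F (y i)) q'
    exact (aeval_sysPoint_inr y (fun i => F (y i)) q).symm.trans
      ((map_eq_zero ι).1 (h6.symm.trans h5))
  · have h6 := sysPoint_algHom (k := k) ι (fun _ j => c (Sum.inl j)) (fun _ l => c (Sum.inr l))
      ((mkDerivation K (sysField f η))^[r] q')
    have h7 := (aeval_sysPoint_const (fun j => c (Sum.inl j)) (fun l => c (Sum.inr l))
      ((mkDerivation K (sysField f η))^[r] q')).trans
      ((congrArg (aeval · _) (Sum.elim_comp_inl_inr c)).trans (hc _ (h3 η hη r)))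
    rw [h7, map_zero] at h6
    rw [IsBranch.point, hFc]
    exact h6

end

end Templates

section Shapes

open MvPolynomial Cardinal

/-- The shape of a tuple: a triangular system it solves, together with a rational box and basic
open sets isolating the solution. -/
structure Shape (n : ℕ) (K : Type) [Field K] where
  dim : ℕ
  sys : Fin n → MvPolynomial (Option (Fin dim)) K
  lo : Fin dim → ℚ
  hi : Fin dim → ℚ
  root : Fin n → TopologicalSpace.countableBasis ℂ

instance (n : ℕ) (K : Type) [Field K] [Countable K] : Countable (Shape n K) := by
  have : ∀ d, Countable (MvPolynomial (Option (Fin d)) K) := fun d =>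
    mk_le_aleph0_iff.1 (cardinalMk_le_max.trans (by simp))
  have : Countable (TopologicalSpace.countableBasis ℂ) :=
    (TopologicalSpace.countable_countableBasis ℂ).to_subtype
  let φ : Shape n K → Σ d : ℕ, (Fin n → MvPolynomial (Option (Fin d)) K) × (Fin d → ℚ) ×
    (Fin d → ℚ) × (Fin n → TopologicalSpace.countableBasis ℂ) :=
    fun S => ⟨S.dim, S.sys, S.lo, S.hi, S.root⟩
  refine Function.Injective.countable (f := φ) ?_
  rintro ⟨d, f, lo, hi, V⟩ ⟨d', f', lo', hi', V'⟩ h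
  obtain ⟨rfl, h⟩ := Sigma.mk.inj_iff.1 h
  simp only [heq_eq_eq, Prod.mk.injEq] at h
  obtain ⟨rfl, rfl, rfl, rfl⟩ := h
  rfl

/-- The parameters `s` witness that the tuple `a` has shape `S`. -/
structure Shape.HasParam {n : ℕ} {K R : Type} [Field K] [Field R] [Algebra K ℝ] [Algebra K R]
    (S : Shape n K) (T : Set R) (Φ : R →ₐ[K] ℂ) (a : Fin n → R) (s : Fin S.dim → R)
    (x : Fin S.dim → ℝ) : Prop where
  mem : ∀ j, s j ∈ T
  isSimpleSol : IsSimpleSol S.sys s a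
  isFullySupported : IsFullySupported S.sys s a
  map_eq : ∀ j, Φ (s j) = x j
  mem_openBox : x ∈ openBox (fun j => S.lo j) (fun j => S.hi j)
  disjoint : ∀ j j', j ≠ j' →
    Disjoint (Set.Ioo (S.lo j : ℝ) (S.hi j)) (Set.Ioo (S.lo j' : ℝ) (S.hi j'))
  isIsolating : IsIsolating S.sys (openBox (fun j => S.lo j) (fun j => S.hi j))
    (fun l => (S.root l).1)
  map_eq_root : (fun l => Φ (a l)) = rootFun S.sys (fun l => (S.root l).1) x

variable {k n : ℕ} {K R : Type} [Field K] [CharZero K] [Field R] [CharZero R] [Algebra K ℝ]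
  [Algebra K R]

omit [CharZero R] in
theorem Shape.exists_hasParam {T : Set R} (hT : IsTranscendenceBasis K ((↑) : T → R))
    (Φ : R →ₐ[K] ℂ) {ρ : T → ℝ} (hρ : ∀ t : T, Φ t = ρ t) (a : Fin n → R) :
    ∃ (S : Shape n K) (s : Fin S.dim → R) (x : Fin S.dim → ℝ), S.HasParam T Φ a s x := by
  obtain ⟨d, s, hs, hsT, f, hf, hf'⟩ := exists_simpleSol hT a
  have hsx : ∀ j, Φ (s j) = ρ ⟨s j, hsT j⟩ := fun j => hρ ⟨s j, hsT j⟩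
  obtain ⟨lo, hi, V, hV, hx, hdisj, hI, ha⟩ := exists_isIsolating (f := f)
    (x := fun j => ρ ⟨s j, hsT j⟩) (a := fun l => Φ (a l)) (by
      simp only [← hsx]
      exact (isSimpleSol_algHom Φ).2 hf)
  refine ⟨⟨d, f, lo, hi, fun l => ⟨V l, hV l⟩⟩, s, fun j => ρ ⟨s j, hsT j⟩,
    hsT, hf, hf', hsx, hx, fun j j' hj => hdisj j j' fun h => hj ?_, hI, ha⟩
  refine hs (Φ.injective ?_)
  change Φ (s j) = Φ (s j')
  rw [hsx, hsx, h]

/-- There is a countable coloring of the tuples over `R` such that every zero of a polynomial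
with entries of the same color comes from a template of real tuples. -/
theorem exists_shape_coloring (hk : 0 < k) [Countable K] (hR : SpecializesToReal K R)
    (hRc : #R ≤ 𝔠) (n : ℕ) :
    ∃ (C : Type) (_ : Countable C) (sh : (Fin n → R) → C) (D : C → ℕ)
      (s : ∀ c, (Fin n → R) → Fin (D c) → R),
      ∀ (q : MvPolynomial (Fin k × Fin n) K) (c : C) (a : Fin k → Fin n → R),
        Function.Injective a → (∀ i, sh (a i) = c) → aeval (fun v => a v.1 v.2) q = 0 →
        Function.Injective (fun i => s c (a i)) ∧ ∃ lo hi F,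
          IsRealTemplate q (fun i i' j => s c (a i) j = s c (a i') j) lo hi F := by
  obtain ⟨T, hT⟩ := exists_isTranscendenceBasis K R
  obtain ⟨Φ, ρ, hρ⟩ := hT.exists_algHom_complex mk_le_aleph0 hRc
  choose sh hsh using fun a : Fin n → R => Shape.exists_hasParam hT Φ hρ a
  have h1 : ∀ (S : Shape n K) (a : Fin n → R), ∃ (s : Fin S.dim → R), sh a = S →
      ∃ x, S.HasParam T Φ a s x := by
    intro S a
    by_cases h : sh a = S
    · subst h
      obtain ⟨s, hs⟩ := hsh a
      exact ⟨s, fun _ => hs⟩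
    · exact ⟨0, fun h' => absurd h' h⟩
  choose s hs using h1
  refine ⟨Shape n K, inferInstance, sh, Shape.dim, s, fun q S a ha hc hq => ?_⟩
  choose x hx using fun i => hs S (a i) (hc i)
  refine ⟨fun i i' h => ha ?_, ?_⟩
  · have h2 : x i = x i' := by
      funext j
      have h3 := (hx i).map_eq j
      rw [show s S (a i) = s S (a i') from h, (hx i').map_eq j] at h3
      exact_mod_cast h3.symm
    have h3 := (hx i).map_eq_root
    rw [h2, ← (hx i').map_eq_root] at h3
    exact funext fun l => Φ.injective (congrFun h3 l)
  · let i₀ : Fin k := ⟨0, hk⟩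
    exact exists_isRealTemplate hk hR hT.1 Φ (hx i₀).isIsolating (hx i₀).disjoint
      (fun i => (hx i).mem) (fun i => (hx i).isSimpleSol) (fun i => (hx i).isFullySupported)
      (fun i => (hx i).map_eq) (fun i => (hx i).mem_openBox) (fun i => (hx i).map_eq_root) hq

end Shapes

section IndependentReals

open MvPolynomial Cardinal

theorem AlgebraicIndependent.add_algebraMap {ι K A : Type*} [CommRing K] [CommRing A] [Algebra K A]
    {x : ι → A} (hx : AlgebraicIndependent K x) (c : ι → K) :
    AlgebraicIndependent K fun i => x i + algebraMap K A (c i) := by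
  let τ : MvPolynomial ι K →ₐ[K] MvPolynomial ι K := aeval fun i => X i + MvPolynomial.C (c i)
  let ψ : MvPolynomial ι K →ₐ[K] MvPolynomial ι K := aeval fun i => X i - MvPolynomial.C (c i)
  have h1 : ψ.comp τ = AlgHom.id K _ := by
    ext i : 1
    simp [τ, ψ]
  have h2 : Function.Injective τ :=
    Function.LeftInverse.injective (g := ψ) fun p => DFunLike.congr_fun h1 p
  have h3 : aeval (fun i => x i + algebraMap K A (c i)) = (aeval x).comp τ := by
    ext i : 1
    simp [τ]
  rw [AlgebraicIndependent, h3, AlgHom.coe_comp]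
  exact (show Function.Injective (aeval x) from hx).comp h2

/-- There are many algebraically independent reals in any box. -/
theorem exists_algebraicIndependent_mem_Ioo {K : Type} [Field K] [CharZero K] [Algebra K ℝ]
    [Countable K] {d : ℕ} {lo hi : Fin d → ℝ} (h : ∀ j, lo j < hi j) {Y : Type} (hY : #Y ≤ 𝔠) :
    ∃ y : Fin d → Y → ℝ, AlgebraicIndependent K (fun v : Fin d × Y => y v.1 v.2) ∧
      ∀ j t, y j t ∈ Set.Ioo (lo j) (hi j) := by
  obtain ⟨S, hS⟩ := exists_isTranscendenceBasis K ℝ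
  have h1 : #(Fin d × Y) ≤ #S := by
    rw [hS.mk_real_eq_continuum mk_le_aleph0, mk_prod, lift_id, lift_id]
    exact mul_le_of_le aleph0_le_continuum ((mk_le_aleph0).trans aleph0_le_continuum) hY
  obtain ⟨e⟩ := h1
  have he : AlgebraicIndependent K fun v => (e v : ℝ) := hS.1.comp e e.injective
  choose c hc using fun v : Fin d × Y =>
    exists_rat_btwn (sub_lt_sub_right (h v.1) (e v : ℝ))
  refine ⟨fun j t => e (j, t) + algebraMap K ℝ (c (j, t)),
    he.add_algebraMap fun v => (c v : K), fun j t => ?_⟩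
  have h2 := hc (j, t)
  simp only [map_ratCast, Set.mem_Ioo]
  constructor <;> linarith [h2.1, h2.2]

theorem specializesToReal_real (K : Type) [Field K] [Algebra K ℝ] : SpecializesToReal K ℝ :=
  fun _ _ v _ hg => ⟨v, fun _ h => h, hg⟩

end IndependentReals

section Hypergraphs

open MvPolynomial Cardinal

section
variable {k d : ℕ} {α V W : Type*}

theorem mem_fimg {g : V → W} {e : Finset V} {y : W} : y ∈ fimg g e ↔ ∃ x ∈ e, g x = y := by
  classical
  simp [fimg]

theorem mem_fimg_univ {a : Fin k → V} {y : V} : y ∈ fimg a Finset.univ ↔ ∃ i, a i = y := by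
  simp [mem_fimg]

theorem card_fimg_univ {a : Fin k → V} :
    (fimg a Finset.univ).card = k ↔ Function.Injective a := by
  classical
  have h : fimg a Finset.univ = Finset.univ.image a := by
    ext y
    simp [mem_fimg]
  rw [h]
  simpa using Finset.card_image_iff (s := Finset.univ) (f := a)

theorem fimg_fimg_univ {a : Fin k → V} {g : V → W} :
    fimg g (fimg a Finset.univ) = fimg (fun i => g (a i)) Finset.univ := by
  ext y
  simp [mem_fimg]

theorem exists_eq_fimg_univ {e : Finset V} (he : e.card = k) :
    ∃ a : Fin k → V, Function.Injective a ∧ fimg a Finset.univ = e := by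
  refine ⟨fun i => (e.equivFinOfCardEq he).symm i,
    Subtype.val_injective.comp (Equiv.injective _), ?_⟩
  ext y
  rw [mem_fimg_univ]
  constructor
  · rintro ⟨i, rfl⟩
    exact Subtype.property _
  · intro hy
    exact ⟨e.equivFinOfCardEq he ⟨y, hy⟩, by simp⟩

/-- `w` is told apart by the coordinates in `I`. -/
def Separates (I : Finset (Fin d)) (w : Fin k → Fin d → α) : Prop :=
  ∀ i i', (∀ j ∈ I, w i j = w i' j) → i = i'

theorem isDistinguisher_fimg_iff {w : Fin k → Fin d → α} (hw : Function.Injective w)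
    {I : Finset (Fin d)} : IsDistinguisher (fimg w Finset.univ) I ↔ Separates I w := by
  simp only [IsDistinguisher, mem_fimg_univ, Separates]
  constructor
  · intro h i i' hi
    by_contra hne
    obtain ⟨j, hj, hj'⟩ := h _ ⟨i, rfl⟩ _ ⟨i', rfl⟩ (hw.ne hne)
    exact hj' (hi j hj)
  · rintro h _ ⟨i, rfl⟩ _ ⟨i', rfl⟩ hne
    by_contra! hi
    exact hne (congrArg w (h i i' hi))

theorem exists_separates {w : Fin k → Fin d → α} (hw : Function.Injective w) :
    ∃ I : Finset (Fin d), Separates I w ∧ I.card = eT (fimg w Finset.univ) := by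
  have h : {e | ∃ I : Finset (Fin d), IsDistinguisher (fimg w Finset.univ) I ∧
      I.card = e}.Nonempty :=
    ⟨_, Finset.univ, (isDistinguisher_fimg_iff hw).2 fun i i' h =>
      hw (funext fun j => h j (Finset.mem_univ j)), rfl⟩
  obtain ⟨I, hI, hI'⟩ := Nat.sInf_mem h
  exact ⟨I, (isDistinguisher_fimg_iff hw).1 hI, hI'⟩

theorem Separates.eT_le {w : Fin k → Fin d → α} {I : Finset (Fin d)} (hI : Separates I w)
    (hw : Function.Injective w) : eT (fimg w Finset.univ) ≤ I.card :=
  Nat.sInf_le ⟨I, (isDistinguisher_fimg_iff hw).2 hI, rfl⟩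

theorem eT_pos {w : Fin k → Fin d → α} (hk : 2 ≤ k) (hw : Function.Injective w) :
    0 < eT (fimg w Finset.univ) := by
  obtain ⟨I, hI, hI'⟩ := exists_separates hw
  rw [← hI', Finset.card_pos, Finset.nonempty_iff_ne_empty]
  rintro rfl
  have := hI ⟨0, by omega⟩ ⟨1, by omega⟩ (by simp)
  simp at this

theorem mem_LEdges_iff (hk : 0 < k) {M : Type*} {w : Fin k → Fin d → α} (hw : Function.Injective w)
    {e : Finset (Fin d → M)} : e ∈ LEdges k (fimg w Finset.univ) M ↔
      ∃ a : Fin k → Fin d → M, Function.Injective a ∧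
        IsCompat (fun i i' j => w i j = w i' j) a ∧ fimg a Finset.univ = e := by
  constructor
  · rintro ⟨he, f, hf, hf', hf''⟩
    have h : fimg (fun i => f (w i)) Finset.univ = e := by
      ext y
      rw [mem_fimg_univ]
      constructor
      · rintro ⟨i, rfl⟩
        exact hf _ (mem_fimg_univ.2 ⟨i, rfl⟩)
      · intro hy
        obtain ⟨x, hx, rfl⟩ := hf' y hy
        obtain ⟨i, rfl⟩ := mem_fimg_univ.1 hx
        exact ⟨i, rfl⟩
    refine ⟨fun i => f (w i), card_fimg_univ.1 (h ▸ he), fun i i' j hij => ?_, h⟩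
    exact hf'' _ (mem_fimg_univ.2 ⟨i, rfl⟩) _ (mem_fimg_univ.2 ⟨i', rfl⟩) j hij
  · rintro ⟨a, ha, hc, rfl⟩
    refine ⟨card_fimg_univ.2 ha, Function.extend w a fun _ => a ⟨0, hk⟩, ?_, ?_, ?_⟩
    all_goals simp only [mem_fimg_univ]
    · rintro _ ⟨i, rfl⟩
      exact ⟨i, (hw.extend_apply _ _ _).symm⟩
    · rintro _ ⟨i, rfl⟩
      exact ⟨w i, ⟨i, rfl⟩, hw.extend_apply _ _ _⟩
    · rintro _ ⟨i, rfl⟩ _ ⟨i', rfl⟩ j hij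
      rw [hw.extend_apply, hw.extend_apply]
      exact hc i i' j hij

theorem embeddable_LEdges_iff (hk : 0 < k) {M : Type*} {w : Fin k → Fin d → α} (hw : Function.Injective w)
    {E : Set (Finset V)} : Embeddable (LEdges k (fimg w Finset.univ) M) E ↔
      ∃ g : (Fin d → M) → V, Function.Injective g ∧ ∀ a : Fin k → Fin d → M,
        Function.Injective a → IsCompat (fun i i' j => w i j = w i' j) a →
          fimg (fun i => g (a i)) Finset.univ ∈ E := by
  simp only [Embeddable, IsHGEmbedding, mem_LEdges_iff hk hw]
  refine exists_congr fun g => and_congr_right fun _ => ⟨fun h a ha hc => ?_, ?_⟩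
  · rw [← fimg_fimg_univ]
    exact h _ ⟨a, ha, hc, rfl⟩
  · rintro h _ ⟨a, ha, hc, rfl⟩
    rw [fimg_fimg_univ]
    exact h a ha hc

end

theorem chromaticNumber_le_iff {V : Type u} {E : Set (Finset V)}
    (hE : ∀ e ∈ E, ∃ x ∈ e, ∃ y ∈ e, x ≠ y) {κ : Cardinal.{u}} :
    chromaticNumber E ≤ κ ↔ ProperlyColorable E κ := by
  have h : {κ | ProperlyColorable E κ}.Nonempty := ⟨#V, V, id, le_rfl, hE⟩
  refine ⟨fun hκ => ?_, fun hκ => csInf_le' hκ⟩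
  obtain ⟨C, φ, hC, hφ⟩ := csInf_mem h
  exact ⟨C, φ, hC.trans hκ, hφ⟩

end Hypergraphs

section UpperBound

open MvPolynomial Cardinal

variable {k n : ℕ}

/-- The product of all the permutations of a `(k, n)`-ary polynomial. -/
noncomputable def symmProd {K : Type*} [CommRing K] (p : MvPolynomial (Fin k × Fin n) K) :
    MvPolynomial (Fin k × Fin n) K :=
  ∏ σ : Equiv.Perm (Fin k), rename (fun v => (σ v.1, v.2)) p

theorem aeval_symmProd_eq_zero_iff {K L : Type*} [CommRing K] [Field L] [Algebra K L]
    {p : MvPolynomial (Fin k × Fin n) K} {a : Fin k → Fin n → L} :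
    aeval (fun v => a v.1 v.2) (symmProd p) = 0 ↔
      ∃ σ : Equiv.Perm (Fin k), aeval (fun v => a (σ v.1) v.2) p = 0 := by
  rw [symmProd, map_prod, Finset.prod_eq_zero_iff]
  simp only [Finset.mem_univ, true_and, aeval_rename]
  rfl

/-- The zero hypergraph is defined, independently of the enumeration, by a polynomial over a
countable field. -/
theorem exists_mem_zeroEdges_iff (p : MvPolynomial (Fin k × Fin n) ℝ) :
    ∃ (K : Subfield ℝ) (_ : Countable K) (q : MvPolynomial (Fin k × Fin n) K),
      ∀ a : Fin k → Fin n → ℝ, Function.Injective a →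
        (fimg a Finset.univ ∈ zeroEdges k n p ↔ aeval (fun v => a v.1 v.2) q = 0) := by
  let K : Subfield ℝ := Subfield.closure (p.coeffs : Set ℝ)
  have hK : Countable K := by
    rw [← mk_le_aleph0_iff]
    refine (Subfield.cardinalMk_closure_le_max _).trans (max_le ?_ le_rfl)
    exact (Set.to_countable _).le_aleph0
  obtain ⟨p', hp⟩ : ∃ p' : MvPolynomial (Fin k × Fin n) K, map (algebraMap K ℝ) p' = p := by
    refine mem_range_map_iff_coeffs_subset.2 fun c hc => ?_
    exact ⟨⟨c, Subfield.subset_closure hc⟩, rfl⟩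
  refine ⟨K, hK, symmProd p', fun a ha => ?_⟩
  have h : ∀ b : Fin k → Fin n → ℝ,
      eval (fun v => b v.1 v.2) p = aeval (fun v => b v.1 v.2) p' := fun b => by
    rw [← hp, eval_map, aeval_def]
  simp only [zeroEdges, Set.mem_ofPred_eq, h]
  rw [aeval_symmProd_eq_zero_iff]
  constructor
  · rintro ⟨b, hb, hba, hb0⟩
    have h1 : ∀ i, ∃ j, a j = b i := fun i => by
      rw [← mem_fimg_univ, ← hba, mem_fimg_univ]
      exact ⟨i, rfl⟩
    choose σ hσ using h1
    have h2 : Function.Injective σ := fun i j hij => hb (by rw [← hσ, ← hσ, hij])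
    refine ⟨Equiv.ofBijective σ (Finite.injective_iff_bijective.1 h2), ?_⟩
    simpa [hσ] using hb0
  · rintro ⟨σ, hσ⟩
    refine ⟨fun i => a (σ i), ha.comp σ.injective, ?_, hσ⟩
    ext y
    rw [mem_fimg_univ, mem_fimg_univ]
    exact (σ.surjective.exists (p := fun i => a i = y)).symm

variable {K : Type} [Field K] [CharZero K] [Algebra K ℝ] [Countable K]

/-- Independent real parameters in the box of a template. -/
theorem IsRealTemplate.exists_injective_family {d : ℕ} {q : MvPolynomial (Fin k × Fin n) K}
    {E : Fin k → Fin k → Fin d → Prop} {lo hi : Fin d → ℝ} {F : (Fin d → ℝ) → Fin n → ℝ}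
    (h : IsRealTemplate q E lo hi F) {Y : Type} (hY : #Y ≤ 𝔠) :
    ∃ G : (Fin d → Y) → Fin n → ℝ, Function.Injective G ∧ ∀ a : Fin k → Fin d → Y,
      IsCompat E a → aeval (fun v => G (a v.1) v.2) q = 0 := by
  obtain ⟨z, hz⟩ := h.nonempty
  obtain ⟨y, hy, hy'⟩ := exists_algebraicIndependent_mem_Ioo (K := K)
    (fun j => (hz j (Set.mem_univ j)).1.trans (hz j (Set.mem_univ j)).2) hY
  refine ⟨fun u => F fun j => y j (u j), h.injective Y y hy hy', fun a ha => ?_⟩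
  exact h.eq_zero (fun i j => y j (a i j)) (fun i j _ => hy' j _) fun i i' j hij =>
    congrArg (y j) (ha i i' j hij)

/-- There is a countable coloring of the tuples such that every monochromatic edge comes from
a template all of whose grids are embeddable. -/
theorem exists_coloring_zeroEdges (hk : 2 ≤ k) (p : MvPolynomial (Fin k × Fin n) ℝ) :
    ∃ (C : Type) (_ : Countable C) (sh : (Fin n → ℝ) → C) (D : C → ℕ)
      (s : ∀ c, (Fin n → ℝ) → Fin (D c) → ℝ), ∀ (c : C) (a : Fin k → Fin n → ℝ),
        Function.Injective a → (∀ i, sh (a i) = c) → fimg a Finset.univ ∈ zeroEdges k n p →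
        Function.Injective (fun i => s c (a i)) ∧
          eT (fimg (fun i => s c (a i)) Finset.univ) - 1 ∈ DepthSet k (zeroEdges k n p) := by
  obtain ⟨K, hK, q, hq⟩ := exists_mem_zeroEdges_iff p
  obtain ⟨C, hC, sh, D, s, h⟩ := exists_shape_coloring (k := k) (by omega)
    (specializesToReal_real K) mk_real.le n
  refine ⟨C, hC, sh, D, s, fun c a ha hc he => ?_⟩
  obtain ⟨hs, lo, hi, F, hF⟩ := h q c a ha hc ((hq a ha).1 he)
  refine ⟨hs, D c, ℝ, fimg (fun i => s c (a i)) Finset.univ, card_fimg_univ.2 hs, ?_, fun M => ?_⟩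
  · have := eT_pos hk hs
    omega
  · obtain ⟨G, hG, hG'⟩ := hF.exists_injective_family (Y := Fin M)
      (by simpa using (nat_lt_continuum M).le)
    refine (embeddable_LEdges_iff (by omega) hs).2 ⟨G, hG, fun b hb hb' => ?_⟩
    exact (hq _ (hG.comp hb)).2 (hG' b hb')

theorem properlyColorable_zeroEdges_of_depthSet_eq_empty (hk : 2 ≤ k)
    {p : MvPolynomial (Fin k × Fin n) ℝ} (h : DepthSet k (zeroEdges k n p) = ∅) :
    ProperlyColorable (zeroEdges k n p) ℵ₀ := by
  obtain ⟨C, hC, sh, D, s, hs⟩ := exists_coloring_zeroEdges hk p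
  refine ⟨C, sh, mk_le_aleph0, fun e he => ?_⟩
  by_contra! hne
  obtain ⟨a, ha, rfl, -⟩ := id he
  have h1 := hs (sh (a ⟨0, by omega⟩)) a ha (fun i => hne _ (mem_fimg_univ.2 ⟨i, rfl⟩) _
    (mem_fimg_univ.2 ⟨_, rfl⟩)) he
  rw [h] at h1
  exact h1.2

theorem properlyColorable_zeroEdges_of_continuum_le (hk : 2 ≤ k)
    {p : MvPolynomial (Fin k × Fin n) ℝ} {κ : Cardinal.{0}} (hκ : ℵ₀ ≤ κ) {δ : ℕ}
    (hδ : ∀ δ' ∈ DepthSet k (zeroEdges k n p), δ ≤ δ') (hc : 𝔠 ≤ Order.succ^[δ] κ) :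
    ProperlyColorable (zeroEdges k n p) κ := by
  obtain ⟨C, hC, sh, D, s, hs⟩ := exists_coloring_zeroEdges hk p
  choose C' c I hC' hI hc' using fun d =>
    exists_coloring_of_card_le hκ d δ ℝ (mk_real.le.trans hc)
  refine ⟨Σ b, C' (D b), fun a => ⟨sh a, c _ (s (sh a) a)⟩, ?_, fun e he => ?_⟩
  · rw [mk_sigma]
    refine (sum_le_sum _ (fun _ => κ) fun b => hC' (D b)).trans ?_
    rw [sum_const, lift_id, lift_id]
    exact mul_le_of_le hκ (mk_le_aleph0.trans hκ) le_rfl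
  · by_contra! hne
    obtain ⟨a, ha, rfl, -⟩ := id he
    let i₀ : Fin k := ⟨0, by omega⟩
    have h1 : ∀ i, (⟨sh (a i), c _ (s (sh (a i)) (a i))⟩ : Σ b, C' (D b)) =
        ⟨sh (a i₀), c _ (s (sh (a i₀)) (a i₀))⟩ := fun i =>
      hne _ (mem_fimg_univ.2 ⟨i, rfl⟩) _ (mem_fimg_univ.2 ⟨_, rfl⟩)
    have h2 : ∀ i, sh (a i) = sh (a i₀) := fun i => (Sigma.mk.inj_iff.1 (h1 i)).1
    have h3 : ∀ i, c _ (s (sh (a i₀)) (a i)) = c _ (s (sh (a i₀)) (a i₀)) := by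
      intro i
      have h4 := h1 i
      rw [h2 i] at h4
      exact eq_of_heq (Sigma.mk.inj_iff.1 h4).2
    obtain ⟨hinj, hmem⟩ := hs _ a ha h2 he
    have h5 : Separates (I _ (c _ (s (sh (a i₀)) (a i₀)))) fun i => s (sh (a i₀)) (a i) := by
      intro i i' hii
      refine hinj (hc' _ _ _ ((h3 i).trans (h3 i').symm) ?_)
      rwa [h3 i]
    have h6 := h5.eT_le hinj
    have h7 := hI _ (c _ (s (sh (a i₀)) (a i₀)))
    have h8 := hδ _ hmem
    have h9 := eT_pos hk hinj
    omega

end UpperBound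

section LimitGrid

open MvPolynomial Cardinal Filter

/-- A field obtained from sequences of reals modulo an ultrafilter. -/
theorem exists_ultrapower (K : Type) [Field K] [Algebra K ℝ] (U : Ultrafilter ℕ) :
    ∃ (L : Type) (_ : Field L) (_ : Algebra K L) (π : (ℕ → ℝ) →ₐ[K] L), Function.Surjective π ∧
      ∀ f, π f = 0 ↔ ∀ᶠ m in U, f m = 0 := by
  let ψ : (ℕ → ℝ) →+* Germ (U : Filter ℕ) ℝ := Germ.coeRingHom _
  let : Algebra K (Germ (U : Filter ℕ) ℝ) := (ψ.comp (algebraMap K (ℕ → ℝ))).toAlgebra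
  let π : (ℕ → ℝ) →ₐ[K] Germ (U : Filter ℕ) ℝ := { ψ with commutes' := fun _ => rfl }
  refine ⟨Germ (U : Filter ℕ) ℝ, inferInstance, inferInstance, π, fun g => ?_, fun f => ?_⟩
  · induction g using Germ.inductionOn with
    | _ f => exact ⟨f, rfl⟩
  · exact Germ.coe_eq (f := f) (g := 0)

theorem aeval_pi_apply {K A σ ι : Type*} [CommRing K] [CommRing A] [Algebra K A] (f : σ → ι → A)
    (m : ι) (h : MvPolynomial σ K) : aeval f h m = aeval (fun i => f i m) h :=
  DFunLike.congr_fun (comp_aeval f (Pi.evalAlgHom K (fun _ => A) m)) h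

theorem specializesToReal_of_ultrapower {K L : Type} [Field K] [Algebra K ℝ] [Field L]
    [Algebra K L] {U : Ultrafilter ℕ} {π : (ℕ → ℝ) →ₐ[K] L} (hπ : Function.Surjective π)
    (hπ0 : ∀ f, π f = 0 ↔ ∀ᶠ m in U, f m = 0) (R : IntermediateField K L) :
    SpecializesToReal K R := by
  intro σ _ v g hg
  choose f hf using fun i => hπ (v i : L)
  have h1 : ∀ h : MvPolynomial σ K, (aeval v h : R) = 0 ↔
      ∀ᶠ m in U, aeval (fun i => f i m) h = 0 := fun h => by
    have h2 : ((aeval v h : R) : L) = π (aeval f h) := by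
      change R.val _ = _
      rw [← AlgHom.comp_apply, ← AlgHom.comp_apply, comp_aeval, comp_aeval]
      congr 2
      funext i
      exact (hf i).symm
    rw [← ZeroMemClass.coe_eq_zero, h2, hπ0]
    simp only [aeval_pi_apply]
  obtain ⟨G, hG⟩ := IsNoetherian.noetherian (RingHom.ker (aeval v : MvPolynomial σ K →ₐ[K] R))
  have h2 : ∀ h ∈ G, ∀ᶠ m in U, aeval (fun i => f i m) h = 0 := fun h hh =>
    (h1 h).1 <| by
      have : h ∈ RingHom.ker (aeval v : MvPolynomial σ K →ₐ[K] R) := hG ▸ Submodule.subset_span hh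
      exact this
  have h3 : ∀ᶠ m in U, aeval (fun i => f i m) g ≠ 0 := by
    rw [Ultrafilter.eventually_not]
    rwa [← h1]
  obtain ⟨m, hm, hm'⟩ := (((eventually_all_finset G).2 h2).and h3).exists
  refine ⟨fun i => f i m, fun h hh => ?_, hm'⟩
  have h4 : Submodule.span _ (G : Set (MvPolynomial σ K)) ≤
      RingHom.ker (aeval (fun i => f i m) : MvPolynomial σ K →ₐ[K] ℝ) :=
    Submodule.span_le.2 fun h hh => hm h hh
  rw [hG] at h4
  exact h4 hh

variable {k n d : ℕ}

/-- Finite grids embedded in the reals assemble to a grid of size up to the continuum in a field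
all of whose finite tuples specialize to the reals. -/
theorem exists_limit_grid {K : Type} [Field K] [Algebra K ℝ] [Countable K]
    {q : MvPolynomial (Fin k × Fin n) K} {E : Fin k → Fin k → Fin d → Prop}
    (g : ∀ M : ℕ, (Fin d → Fin M) → Fin n → ℝ) (hg : ∀ M, Function.Injective (g M))
    (hgq : ∀ M (a : Fin k → Fin d → Fin M), Function.Injective a → IsCompat E a →
      aeval (fun v => g M (a v.1) v.2) q = 0)
    {X : Type} (hX : #X ≤ 𝔠) (hX' : ℵ₀ ≤ #X) :
    ∃ (R : Type) (_ : Field R) (_ : Algebra K R) (G : (Fin d → X) → Fin n → R),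
      SpecializesToReal K R ∧ #R ≤ #X ∧ Function.Injective G ∧
      ∀ a : Fin k → Fin d → X, Function.Injective a → IsCompat E a →
        aeval (fun v => G (a v.1) v.2) q = 0 := by
  have hU := Nat.hyperfilter_le_atTop
  set U := hyperfilter ℕ
  obtain ⟨L, _, _, π, hπ, hπ0⟩ := exists_ultrapower K U
  have hXι : #X ≤ #(ℕ → Bool) := by simpa using hX
  obtain ⟨ι⟩ := hXι
  let tr : ∀ m : ℕ, X → Fin (2 ^ m) := fun m x => finFunctionFinEquiv fun i : Fin m => 
    finTwoEquiv.symm (ι x i)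
  have htr : ∀ x y, x ≠ y → ∀ᶠ m in U, tr m x ≠ tr m y := by
    intro x y hxy
    obtain ⟨i, hi⟩ := Function.ne_iff.1 (ι.injective.ne hxy)
    refine hU ((eventually_gt_atTop i).mono fun m hm h => hi ?_)
    have := congrFun (finFunctionFinEquiv.injective h) ⟨i, hm⟩
    exact finTwoEquiv.symm.injective this
  have htr' : ∀ u u' : Fin d → X, u ≠ u' →
      ∀ᶠ m in U, (fun j => tr m (u j)) ≠ fun j => tr m (u' j) := by
    intro u u' hu
    obtain ⟨j, hj⟩ := Function.ne_iff.1 hu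
    exact (htr _ _ hj).mono fun m hm h => hm (congrFun h j)
  let γ : (Fin d → X) → Fin n → ℕ → ℝ := fun u l m => g (2 ^ m) (fun j => tr m (u j)) l
  let S : Set L := Set.range fun v : (Fin d → X) × Fin n => π (γ v.1 v.2)
  let R := IntermediateField.adjoin K S
  let G : (Fin d → X) → Fin n → R := fun u l =>
    ⟨π (γ u l), IntermediateField.subset_adjoin K S ⟨(u, l), rfl⟩⟩
  refine ⟨R, inferInstance, inferInstance, G, specializesToReal_of_ultrapower hπ hπ0 R, ?_,
    fun u u' h => ?_, fun a ha hc => ?_⟩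
  · refine (IntermediateField.cardinalMk_adjoin_le K S).trans (max_le (max_le ?_ ?_) hX')
    · exact mk_le_aleph0.trans hX'
    · refine mk_range_le.trans ?_
      rw [mk_prod, lift_id, lift_id, ← power_def, mk_fin]
      exact mul_le_of_le hX' (power_nat_le hX') (mk_le_aleph0.trans hX')
  · by_contra hne
    have h1 : ∀ l, ∀ᶠ m in U, γ u l m = γ u' l m := fun l => by
      have h2 : π (γ u l - γ u' l) = 0 := by
        rw [map_sub, sub_eq_zero]
        exact congrArg Subtype.val (congrFun h l)
      exact ((hπ0 _).1 h2).mono fun m hm => sub_eq_zero.1 hm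
    obtain ⟨m, hm, hm'⟩ := ((eventually_all.2 h1).and (htr' u u' hne)).exists
    exact hm' (hg _ (funext hm))
  · have h1 : ((aeval (fun v => G (a v.1) v.2) q : R) : L) =
        π (aeval (fun v => γ (a v.1) v.2) q) := by
      change R.val _ = _
      rw [← AlgHom.comp_apply, ← AlgHom.comp_apply, comp_aeval, comp_aeval]
      rfl
    rw [← ZeroMemClass.coe_eq_zero, h1, hπ0]
    have h2 : ∀ᶠ m in U, Function.Injective fun i j => tr m (a i j) := by
      have : ∀ i i', ∀ᶠ m in U, i ≠ i' → (fun j => tr m (a i j)) ≠ fun j => tr m (a i' j) := by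
        intro i i'
        by_cases h : i = i'
        · exact .of_forall fun m hm => absurd h hm
        · exact (htr' _ _ (ha.ne h)).mono fun m hm _ => hm
      refine (eventually_all.2 fun i => eventually_all.2 (this i)).mono fun m hm i i' h => ?_
      by_contra hne
      exact hm i i' hne h
    refine h2.mono fun m hm => ?_
    have h3 := hgq _ _ hm fun i i' j hij => congrArg (tr m) (hc i i' j hij)
    rwa [aeval_pi_apply]

end LimitGrid

section LowerBound

open MvPolynomial Cardinal

variable {k n : ℕ}

theorem Separates.exists_monochromatic {κ : Cardinal.{0}} (hκ : ℵ₀ ≤ κ) {d : ℕ} {α : Type}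
    {w : Fin k → Fin d → α} {I : Finset (Fin d)} (hI : Separates I w) {X C : Type}
    (hX : Order.succ^[I.card] κ ≤ #X) (hC : #C ≤ κ) (φ : (Fin d → X) → C) :
    ∃ a : Fin k → Fin d → X, Function.Injective a ∧
      IsCompat (fun i i' j => w i j = w i' j) a ∧ ∃ c, ∀ i, φ (a i) = c := by
  obtain ⟨h, hh, c, hc⟩ := exists_monochromatic_grid hκ
    (Set.range fun v : Fin k × Fin d => w v.1 v.2) I X C hX hC φ
  refine ⟨fun i j => h j ⟨w i j, (i, j), rfl⟩, fun i i' hii => hI i i' fun j hj => ?_,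
    fun i i' j hij => ?_, c, fun i => hc _⟩
  · exact congrArg Subtype.val (hh j hj (congrFun hii j))
  · exact congrArg (h j) (Subtype.ext hij)

theorem continuum_le_of_properlyColorable (hk : 2 ≤ k) {p : MvPolynomial (Fin k × Fin n) ℝ}
    {κ : Cardinal.{0}} (hκ : ℵ₀ ≤ κ) {δ : ℕ} (hδ : δ ∈ DepthSet k (zeroEdges k n p))
    (hcol : ProperlyColorable (zeroEdges k n p) κ) : 𝔠 ≤ Order.succ^[δ] κ := by
  by_contra! hlt
  have hle : Order.succ^[δ + 1] κ ≤ 𝔠 := by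
    rw [Function.iterate_succ_apply']
    exact Order.succ_le_of_lt hlt
  have hle' : Order.succ^[δ + 1] ℵ₀ ≤ 𝔠 := (Order.succ_mono.iterate _ hκ).trans hle
  have hmono : ∀ m ≤ δ + 1, Order.succ^[m] κ ≤ #ℝ := fun m hm => by
    rw [mk_real]
    exact (Function.monotone_iterate_of_id_le Order.le_succ hm κ).trans hle
  obtain ⟨d, α, P, hP, heP, hemb⟩ := hδ
  obtain ⟨w, hw, rfl⟩ := exists_eq_fimg_univ hP
  obtain ⟨I, hI, hIe⟩ := exists_separates hw
  rw [heP] at hIe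
  obtain ⟨K, hK, q, hq⟩ := exists_mem_zeroEdges_iff p
  choose g hg hgE using fun M => (embeddable_LEdges_iff (by omega) hw).1 (hemb M)
  let X : Type := (Order.succ^[δ + 1] ℵ₀).out
  have hX : #X = Order.succ^[δ + 1] ℵ₀ := mk_out _
  obtain ⟨R, _, _, G, hR, hRX, hG, hGq⟩ := exists_limit_grid g hg
    (fun M a ha hc => (hq _ ((hg M).comp ha)).1 (hgE M a ha hc)) (hX.le.trans hle')
    (hX ▸ le_succ_iterate _ _)
  have : CharZero R := charZero_of_injective_algebraMap (algebraMap K R).injective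
  obtain ⟨C, hC, sh, D, s, hs⟩ := exists_shape_coloring (k := k) (by omega) hR
    (hRX.trans (hX.le.trans hle')) n
  choose C' c J hC' hJ hc using fun d =>
    exists_coloring_of_card_le le_rfl d (δ + 1) R (hRX.trans hX.le)
  have hcard : #(Σ b, C' (D b)) ≤ ℵ₀ := by
    rw [mk_sigma]
    refine (sum_le_sum _ (fun _ => ℵ₀) fun b => hC' (D b)).trans ?_
    rw [sum_const, lift_id, lift_id]
    exact mul_le_of_le le_rfl mk_le_aleph0 le_rfl
  obtain ⟨a, ha, hac, ⟨b, β⟩, hbβ⟩ := hI.exists_monochromatic le_rfl (by rw [hX, hIe]) hcard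
    fun u => ⟨sh (G u), c _ (s (sh (G u)) (G u))⟩
  have h2 : ∀ i, sh (G (a i)) = b := fun i => (Sigma.mk.inj_iff.1 (hbβ i)).1
  have h3 : ∀ i, c _ (s b (G (a i))) = β := by
    intro i
    have h4 := hbβ i
    rw [h2 i] at h4
    exact eq_of_heq (Sigma.mk.inj_iff.1 h4).2
  obtain ⟨hinj, lo, hi, F, hF⟩ := hs q b (fun i => G (a i)) (hG.comp ha) h2 (hGq a ha hac)
  have h5 : Separates (J _ β) fun i => s b (G (a i)) := by
    intro i i' hii
    refine hinj (hc _ _ _ ((h3 i).trans (h3 i').symm) ?_)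
    rwa [h3 i]
  obtain ⟨G', hG', hGq'⟩ := hF.exists_injective_family (Y := ℝ) mk_real.le
  obtain ⟨B, φ, hB, hφ⟩ := hcol
  obtain ⟨a', ha', hac', b', hb'⟩ := h5.exists_monochromatic hκ (hmono _ (hJ _ β)) hB
    fun u => φ (G' u)
  obtain ⟨x, hx, y, hy, hxy⟩ := hφ _ ((hq _ (hG'.comp ha')).2 (hGq' a' hac'))
  obtain ⟨i, rfl⟩ := mem_fimg_univ.1 hx
  obtain ⟨i', rfl⟩ := mem_fimg_univ.1 hy
  exact hxy ((hb' i).trans (hb' i').symm)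

end LowerBound

/-- Suppose `H` is an algebraic `k`-hypergraph, `δ = dep(H)`, and `κ` is an infinite
cardinal.  If `δ < ω` then `χ(H) ≤ κ` iff `κ⁺⁽δ⁾ ≥ 2^ℵ₀`; if `δ = ∞` then `χ(H) ≤ κ`. -/
theorem chromatic_le_iff_depth (k n : ℕ) (hk : 2 ≤ k)
    (p : MvPolynomial (Fin k × Fin n) ℝ) (κ : Cardinal.{0}) (hκ : Cardinal.aleph0 ≤ κ) :
    (∀ δ : ℕ, IsLeast (DepthSet k (zeroEdges k n p)) δ →
      (chromaticNumber (zeroEdges k n p) ≤ κ ↔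
        Cardinal.continuum ≤ (Order.succ)^[δ] κ)) ∧
    (DepthSet k (zeroEdges k n p) = ∅ → chromaticNumber (zeroEdges k n p) ≤ κ) := by
  have h : ∀ e ∈ zeroEdges k n p, ∃ x ∈ e, ∃ y ∈ e, x ≠ y := by
    rintro _ ⟨a, ha, rfl, -⟩
    exact ⟨_, mem_fimg_univ.2 ⟨⟨0, by omega⟩, rfl⟩, _, mem_fimg_univ.2 ⟨⟨1, by omega⟩, rfl⟩,
      ha.ne (by simp)⟩
  rw [chromaticNumber_le_iff h]
  refine ⟨fun δ hδ => ⟨continuum_le_of_properlyColorable hk hκ hδ.1,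
    properlyColorable_zeroEdges_of_continuum_le hk hκ hδ.2⟩, fun h0 => ?_⟩
  obtain ⟨C, φ, hC, hφ⟩ := properlyColorable_zeroEdges_of_depthSet_eq_empty hk h0
  exact ⟨C, φ, hC.trans hκ, hφ⟩
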